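/- arXiv:1301.4657 — 4 statements merged into one kernel-verified Lean document; each statement's English description precedes it below -/
import Mathlib

section
/- Let n be an odd positive integer. A finite simple graph G has a spanning subgraph F such that every vertex has degree in {1, 3, 5, ..., n} in F if and only if for every subset S of vertices, the number of connected components of G − S with an odd number of vertices is at most n·|S|. -/
open SimpleGraph

/-- Number of odd-order components of `G - S`. -/
noncomputable def oddComp {V : Type*} [Fintype V] (G : SimpleGraph V) (S : Set V) : ℕ :=
  Nat.card {c : (G.induce Sᶜ).ConnectedComponent // Odd (Nat.card c.supp)}

/-- Degree of `v` in `F` (no decidability assumptions). -/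
noncomputable def ndeg {V : Type*} (F : SimpleGraph V) (v : V) : ℕ :=
  Nat.card (F.neighborSet v)

namespace SimpleGraph

variable {V : Type*}

/-- If `F` is a subgraph of `G` with all degrees odd, then every odd component of `G - S` is joined
to `S` by an edge of `F`. -/
lemma exists_adj_of_odd_component [Finite V] {F G : SimpleGraph V} (hFG : F ≤ G)
    (hF : ∀ v, Odd (ndeg F v)) {S : Set V} (c : (G.induce Sᶜ).ConnectedComponent)
    (hc : Odd (Nat.card c.supp)) :
    ∃ v : (Sᶜ : Set V), ∃ s : V, v ∈ c.supp ∧ s ∈ S ∧ F.Adj s v := by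
  classical
  have := Fintype.ofFinite V
  by_contra! hcon
  let F' : SimpleGraph c.supp := F.comap fun v ↦ (v : (Sᶜ : Set V)).1
  have hdeg (v : c.supp) : F'.degree v = ndeg F v.1.1 := by
    rw [ndeg, ← card_neighborSet_eq_degree, ← Nat.card_eq_fintype_card]
    refine Nat.card_congr (Equiv.ofBijective (fun w ↦ ⟨w.1.1.1, w.2⟩) ⟨?_, ?_⟩)
    · intro a b hab
      simpa [Subtype.ext_iff] using hab
    · rintro ⟨w, hw⟩
      have hwS : w ∉ S := fun h ↦ hcon v.1 w v.2 h hw.symm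
      have hadj : (G.induce Sᶜ).Adj v.1 ⟨w, hwS⟩ := hFG hw
      exact ⟨⟨⟨⟨w, hwS⟩, (c.mem_supp_congr_adj hadj).1 v.2⟩, hw⟩, rfl⟩
  have heven := F'.even_card_odd_degree_vertices
  simp only [hdeg, hF, Finset.filter_true, Finset.card_univ, ← Nat.card_eq_fintype_card] at heven
  exact Nat.not_even_iff_odd.2 hc heven

/-- A subgraph with all degrees odd and at most `n` bounds the number of odd components of
`G - S` by `n * |S|`. -/
lemma oddComp_le_of_odd_factor [Fintype V] {F G : SimpleGraph V} {n : ℕ} (hFG : F ≤ G)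
    (hF : ∀ v, Odd (ndeg F v) ∧ ndeg F v ≤ n) (S : Finset V) :
    oddComp G (S : Set V) ≤ n * S.card := by
  classical
  choose v s hv hs hadj using fun c : {c : (G.induce (S : Set V)ᶜ).ConnectedComponent //
    Odd (Nat.card c.supp)} ↦ exists_adj_of_odd_component hFG (fun v ↦ (hF v).1) c.1 c.2
  let f (c : {c : (G.induce (S : Set V)ᶜ).ConnectedComponent // Odd (Nat.card c.supp)}) :
      Σ s : S, F.neighborSet s := ⟨⟨s c, hs c⟩, ⟨v c, hadj c⟩⟩
  have hf : f.Injective := by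
    intro c d hcd
    have hvcd : v c = v d := by
      have : (fun x : (Σ s : S, F.neighborSet s) ↦ (x.2 : V)) (f c) = (f d).2 := by rw [hcd]
      exact Subtype.ext this
    exact Subtype.ext (ConnectedComponent.eq_of_common_vertex (hv c) (hvcd ▸ hv d))
  calc oddComp G (S : Set V) ≤ Nat.card (Σ s : S, F.neighborSet s) :=
        Nat.card_le_card_of_injective f hf
    _ = ∑ s : S, ndeg F s := Nat.card_sigma
    _ ≤ ∑ _s : S, n := Finset.sum_le_sum fun s _ ↦ (hF s).2
    _ = n * S.card := by simp [mul_comm]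

/-- The graph obtained from `G` by replacing every vertex by a clique on `ι` and every edge by a
complete bipartite graph. -/
def cliqueBlowup (G : SimpleGraph V) (ι : Type*) : SimpleGraph (V × ι) where
  Adj p q := p ≠ q ∧ (p.1 = q.1 ∨ G.Adj p.1 q.1)
  symm := ⟨fun _ _ h ↦ ⟨h.1.symm, h.2.imp Eq.symm Adj.symm⟩⟩
  loopless := ⟨fun _ h ↦ h.1 rfl⟩

/-- A perfect matching of the blow-up by cliques of odd order `n` projects, with multiplicities
taken modulo two, to a subgraph with all degrees odd and at most `n`. -/
lemma exists_odd_factor_of_isPerfectMatching [Finite V] {G : SimpleGraph V} {n : ℕ} (hn : Odd n)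
    {M : (G.cliqueBlowup (Fin n)).Subgraph} (hM : M.IsPerfectMatching) :
    ∃ F : SimpleGraph V, F ≤ G ∧ ∀ v : V, Odd (ndeg F v) ∧ ndeg F v ≤ n := by
  classical
  have := Fintype.ofFinite V
  choose f hf hfu using fun p ↦ hM.1 (hM.2 p)
  have hff (p) : f (f p) = p := (hfu _ _ (hf p).symm).symm
  have hfne (p) : f p ≠ p := (hf p).ne.symm
  let E (v w : V) : Finset (V × Fin n) := {p | p.1 = v ∧ (f p).1 = w}
  have hEsymm (v w : V) : (E v w).card = (E w v).card := by
    refine Finset.card_bij' (fun p _ ↦ f p) (fun p _ ↦ f p) ?_ ?_ ?_ ?_ <;>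
      simp +contextual [E, hff]
  have hEeven (v : V) : Even (E v v).card := by
    rw [← ZMod.natCast_eq_zero_iff_even, Finset.cast_card]
    refine Finset.sum_involution (fun p _ ↦ f p) ?_ ?_ ?_ ?_
    · intros; decide
    · intro p _ _; exact hfne p
    · simp +contextual [E, hff]
    · simp [hff]
  have hEsum (v : V) : ∑ w, (E v w).card = n := by
    have h := Finset.card_eq_sum_card_fiberwise (s := ({p | p.1 = v} : Finset (V × Fin n)))
      (t := Finset.univ) (f := fun p ↦ (f p).1) (by simp)
    have hcard : ({p | p.1 = v} : Finset (V × Fin n)).card = n := by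
      have : ({p | p.1 = v} : Finset (V × Fin n)) = {v} ×ˢ Finset.univ := by
        ext p; simp only [Finset.mem_filter, Finset.mem_product, Finset.mem_singleton,
          Finset.mem_univ, true_and, and_true]
      simp [this]
    rw [hcard] at h
    simpa [E, Finset.filter_filter] using h.symm
  let F : SimpleGraph V :=
    { Adj := fun v w ↦ Odd (E v w).card
      symm := ⟨fun v w h ↦ by rwa [hEsymm]⟩
      loopless := ⟨fun v h ↦ Nat.not_even_iff_odd.2 h (hEeven v)⟩ }
  have hdeg (v : V) : ndeg F v = ({w | Odd (E v w).card} : Finset V).card := by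
    rw [ndeg, Nat.card_eq_fintype_card, Fintype.card_ofFinset]
    rfl
  refine ⟨F, fun v w hvw ↦ ?_, fun v ↦ ⟨?_, ?_⟩⟩
  · obtain ⟨p, hp⟩ := Finset.card_pos.1 hvw.pos
    obtain ⟨-, rfl, rfl⟩ := Finset.mem_filter.1 hp
    exact (hf p).adj_sub.2.resolve_left hvw.ne
  · rw [hdeg, ← Finset.odd_sum_iff_odd_card_odd, hEsum]
    exact hn
  · rw [hdeg, Finset.card_filter]
    refine le_of_le_of_eq ?_ (hEsum v)
    refine Finset.sum_le_sum fun w _ ↦ ?_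
    split_ifs with h
    exacts [h.pos, Nat.zero_le _]

/-- If `o(G - S) ≤ n * |S|` for all `S`, then the blow-up of `G` by cliques of order `n`
satisfies Tutte's condition. -/
lemma not_isTutteViolator_cliqueBlowup [Fintype V] {G : SimpleGraph V} {n : ℕ}
    (h : ∀ S : Finset V, oddComp G (S : Set V) ≤ n * S.card) (u : Set (V × Fin n)) :
    ¬ (G.cliqueBlowup (Fin n)).IsTutteViolator u := by
  classical
  let S : Finset V := {v | ∀ i, (v, i) ∈ u}
  let K := ((⊤ : (G.cliqueBlowup (Fin n)).Subgraph).deleteVerts u).coe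
  let G' := G.induce (S : Set V)ᶜ
  have hmem {p : V × Fin n} : p ∈ ((⊤ : (G.cliqueBlowup (Fin n)).Subgraph).deleteVerts u).verts ↔
      p ∉ u := by simp
  let π (p : ((⊤ : (G.cliqueBlowup (Fin n)).Subgraph).deleteVerts u).verts) :
      ((S : Set V)ᶜ : Set V) :=
    ⟨p.1.1, fun hp ↦ hmem.1 p.2 ((Finset.mem_filter.1 hp).2 _)⟩
  have hKadj {p q} : K.Adj p q ↔ p ≠ q ∧ (π p = π q ∨ G'.Adj (π p) (π q)) := by
    have hp := hmem.1 p.2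
    have hq := hmem.1 q.2
    simp only [K, Subgraph.coe_adj, Subgraph.deleteVerts_adj, Subgraph.verts_top, Set.mem_univ,
      Subgraph.top_adj, true_and, hp, hq, not_false_eq_true]
    exact and_congr Subtype.val_inj.not (or_congr
      ⟨fun h ↦ Subtype.ext h, fun h ↦ congrArg Subtype.val h⟩ Iff.rfl)
  have hto {p q} (hpq : K.Reachable p q) : G'.Reachable (π p) (π q) := by
    obtain ⟨w⟩ := hpq
    induction w with
    | nil => rfl
    | cons hadj _ ih =>
      refine Reachable.trans ?_ ih
      obtain h' | h' := (hKadj.1 hadj).2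
      · rw [h']
      · exact h'.reachable
  have hfiber {p q} (hpq : π p = π q) : K.Reachable p q := by
    by_cases hne : p = q
    · rw [hne]
    · exact (hKadj.2 ⟨hne, .inl hpq⟩).reachable
  have hsurj (v) : ∃ p, π p = v := by
    obtain ⟨v, hv⟩ := v
    obtain ⟨i, hi⟩ : ∃ i, (v, i) ∉ u := by simpa [S] using hv
    exact ⟨⟨(v, i), hmem.2 hi⟩, rfl⟩
  have hfrom {p q} (hpq : G'.Reachable (π p) (π q)) : K.Reachable p q := by
    obtain ⟨w⟩ := hpq
    generalize hx : π p = x at w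
    generalize hy : π q = y at w
    induction w generalizing p with
    | nil => exact hfiber (hx.trans hy.symm)
    | @cons a b _ hadj _ ih =>
      obtain ⟨r, hr⟩ := hsurj b
      refine Reachable.trans ?_ (ih hr hy)
      refine (hKadj.2 ⟨?_, .inr (by rwa [hx, hr])⟩).reachable
      rintro rfl
      exact hadj.ne (hx.symm.trans hr)
  let φ (c : K.ConnectedComponent) : G'.ConnectedComponent := G'.connectedComponentMk (π c.out)
  have hφ {c p} : π p ∈ (φ c).supp ↔ p ∈ c.supp := by
    calc G'.connectedComponentMk (π p) = φ c ↔ K.Reachable p c.out :=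
          ConnectedComponent.eq.trans ⟨hfrom, hto⟩
      _ ↔ K.connectedComponentMk p = K.connectedComponentMk c.out := ConnectedComponent.eq.symm
      _ ↔ p ∈ c.supp := by rw [show K.connectedComponentMk c.out = c from Quot.out_eq c]; rfl
  have hφinj : φ.Injective := by
    intro c d hcd
    obtain ⟨p, hp⟩ := c.nonempty_supp
    exact ConnectedComponent.eq_of_common_vertex hp (hφ.1 (hcd ▸ hφ.2 hp))
  have hodd (c : K.ConnectedComponent) (hc : Odd c.supp.ncard) :
      Odd (Nat.card (φ c).supp) ∨ ∃ p ∈ u, ∃ v ∈ (φ c).supp, v.1 = p.1 := by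
    by_contra! hcon
    obtain ⟨heven, hu⟩ := hcon
    refine heven ?_
    have e : c.supp ≃ (φ c).supp × Fin n :=
      { toFun := fun p ↦ (⟨π p.1, hφ.2 p.2⟩, p.1.1.2)
        invFun := fun x ↦ ⟨⟨(x.1.1.1, x.2), hmem.2 fun hx ↦ hu _ hx _ x.1.2 rfl⟩, hφ.1 x.1.2⟩
        left_inv := fun _ ↦ rfl
        right_inv := fun _ ↦ rfl }
    rw [← Nat.card_coe_set_eq, Nat.card_congr e, Nat.card_prod, Nat.odd_mul] at hc
    exact hc.1
  let R : Set (V × Fin n) := u \ (S : Set V) ×ˢ Set.univ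
  have hchoice (c : K.oddComponents) :
      ∃ x : {c : G'.ConnectedComponent // Odd (Nat.card c.supp)} ⊕ R,
      Sum.elim (fun d ↦ φ c.1 = d.1) (fun p ↦ ∃ v ∈ (φ c.1).supp, v.1 = p.1.1) x := by
    obtain h' | ⟨p, hp, v, hv, hvp⟩ := hodd c.1 c.2
    · exact ⟨.inl ⟨_, h'⟩, rfl⟩
    · exact ⟨.inr ⟨p, hp, fun hpS ↦ v.2 (hvp ▸ hpS.1)⟩, v, hv, hvp⟩
  choose g hg using hchoice
  have hginj : g.Injective := by
    intro c d hcd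
    have hc := hg c
    have hd := hg d
    rw [← hcd] at hd
    refine Subtype.ext (hφinj ?_)
    cases hx : g c with
    | inl x =>
      rw [hx] at hc hd
      exact hc.trans hd.symm
    | inr x =>
      rw [hx] at hc hd
      obtain ⟨v, hv, hvx⟩ := hc
      obtain ⟨w, hw, hwx⟩ := hd
      obtain rfl : v = w := Subtype.ext (hvx.trans hwx.symm)
      exact ConnectedComponent.eq_of_common_vertex hv hw
  have hSu : (S : Set V) ×ˢ (Set.univ : Set (Fin n)) ⊆ u := fun p hp ↦
    (Finset.mem_filter.1 hp.1).2 p.2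
  rw [IsTutteViolator, not_lt]
  calc K.oddComponents.ncard
      ≤ Nat.card ({c : G'.ConnectedComponent // Odd (Nat.card c.supp)} ⊕ R) := by
        rw [← Nat.card_coe_set_eq]
        exact Nat.card_le_card_of_injective g hginj
    _ = oddComp G (S : Set V) + R.ncard := by rw [Nat.card_sum, Nat.card_coe_set_eq, oddComp]
    _ ≤ n * S.card + R.ncard := Nat.add_le_add_right (h S) _
    _ = ((S : Set V) ×ˢ (Set.univ : Set (Fin n))).ncard + R.ncard := by
        rw [Set.ncard_prod, Set.ncard_coe_finset, Set.ncard_univ, Nat.card_fin, mul_comm]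
    _ = u.ncard := by rw [add_comm, Set.ncard_sdiff_add_ncard_of_subset hSu]

end SimpleGraph

/-- Amahashi's theorem: `G` has a `(1,n)`-odd factor iff `o(G-S) ≤ n|S|` for all `S`. -/
theorem stmt_0 {V : Type*} [Fintype V] (G : SimpleGraph V) (n : ℕ) (hn : Odd n) (hpos : 0 < n) :
    (∃ F : SimpleGraph V, F ≤ G ∧ ∀ v : V, Odd (ndeg F v) ∧ ndeg F v ≤ n) ↔
      (∀ S : Finset V, oddComp G (↑S : Set V) ≤ n * S.card) := by
  refine ⟨fun ⟨F, hFG, hF⟩ ↦ oddComp_le_of_odd_factor hFG hF, fun h ↦ ?_⟩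
  obtain ⟨M, hM⟩ := tutte.2 (not_isTutteViolator_cliqueBlowup h)
  exact exists_odd_factor_of_isPerfectMatching hn hM
end

section
/- Let G be a finite simple graph of even order and f : V(G) → ℕ an even-valued function with f(v) ≥ 4 for all v. If o(G − S) ≤ Σ_{v∈S} f(v) for every subset S ⊆ V(G), then G has a spanning subgraph F such that for every vertex v, d_F(v) ∈ {1, 3, ..., f(v)−1} ∪ {f(v)}. -/
open SimpleGraph

/-- `K` misses `T` and is closed under taking neighbours outside `T`. -/
def IsClosedOff {V : Type*} (G : SimpleGraph V) (T K : Finset V) : Prop :=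
  Disjoint K T ∧ ∀ a ∈ K, ∀ b, G.Adj a b → b ∉ T → b ∈ K

/-- `K` is the vertex set of a component of `G - T`, that is, a minimal nonempty closed-off set. -/
def IsComp {V : Type*} (G : SimpleGraph V) (T K : Finset V) : Prop :=
  K.Nonempty ∧ IsClosedOff G T K ∧ ∀ L ⊆ K, L.Nonempty → IsClosedOff G T L → L = K

section Components

open scoped Classical

variable {V : Type*} {G : SimpleGraph V} {S T K L : Finset V}

lemma IsClosedOff.inter (hK : IsClosedOff G S K) (hL : IsClosedOff G T L) (hST : S ⊆ T) :
    IsClosedOff G T (K ∩ L) := by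
  refine ⟨hL.1.mono_left Finset.inter_subset_right, fun a ha b hab hb => ?_⟩
  rw [Finset.mem_inter] at ha ⊢
  exact ⟨hK.2 a ha.1 b hab fun h => hb (hST h), hL.2 a ha.2 b hab hb⟩

lemma IsClosedOff.sdiff (hK : IsClosedOff G T K) (hL : IsClosedOff G T L) :
    IsClosedOff G T (K \ L) := by
  refine ⟨hK.1.mono_left Finset.sdiff_subset, fun a ha b hab hb => ?_⟩
  rw [Finset.mem_sdiff] at ha ⊢
  refine ⟨hK.2 a ha.1 b hab hb, fun hbL => ha.2 (hL.2 b hbL a hab.symm ?_)⟩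
  exact fun haT => Finset.disjoint_left.1 hK.1 ha.1 haT

/-- A component of `G - T` meeting a component of `G - S` with `S ⊆ T` is contained in it. -/
lemma IsComp.subset_of_mem (hK : IsComp G S K) (hL : IsComp G T L) (hST : S ⊆ T) {v : V}
    (hvK : v ∈ K) (hvL : v ∈ L) : L ⊆ K := by
  have h := hL.2.2 (K ∩ L) Finset.inter_subset_right ⟨v, Finset.mem_inter.2 ⟨hvK, hvL⟩⟩
    (hK.2.1.inter hL.2.1 hST)
  rw [← h]
  exact Finset.inter_subset_left

lemma IsComp.eq_of_mem (hK : IsComp G T K) (hL : IsComp G T L) {v : V}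
    (hvK : v ∈ K) (hvL : v ∈ L) : K = L :=
  (hL.subset_of_mem hK subset_rfl hvL hvK).antisymm (hK.subset_of_mem hL subset_rfl hvK hvL)

lemma IsComp.notMem (hK : IsComp G T K) {v : V} (hv : v ∈ K) : v ∉ T :=
  Finset.disjoint_left.1 hK.2.1.1 hv

lemma IsComp.congr (hK : IsComp G S K) (hKT : Disjoint K T)
    (h : ∀ a ∈ K, ∀ b, G.Adj a b → (b ∈ S ↔ b ∈ T)) : IsComp G T K := by
  refine ⟨hK.1, ⟨hKT, fun a ha b hab hb => hK.2.1.2 a ha b hab ?_⟩, fun L hLK hL hLT => ?_⟩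
  · rwa [h a ha b hab]
  · refine hK.2.2 L hLK hL ⟨hK.2.1.1.mono_left hLK, fun a ha b hab hb => hLT.2 a ha b hab ?_⟩
    rwa [← h a (hLK ha) b hab]

variable [Fintype V]

lemma exists_isComp_of_notMem (G : SimpleGraph V) {v : V} (hv : v ∉ T) :
    ∃ K, IsComp G T K ∧ v ∈ K := by
  obtain ⟨K, hK, hmin⟩ := Finset.exists_min_image
    (Finset.univ.filter fun K : Finset V => v ∈ K ∧ IsClosedOff G T K) Finset.card
    ⟨Tᶜ, by
      rw [Finset.mem_filter]
      exact ⟨Finset.mem_univ _, Finset.mem_compl.2 hv, disjoint_compl_left,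
        fun a _ b _ hb => Finset.mem_compl.2 hb⟩⟩
  simp only [Finset.mem_filter, Finset.mem_univ, true_and] at hK hmin
  refine ⟨K, ⟨⟨v, hK.1⟩, hK.2, fun L hLK hL hLT => ?_⟩, hK.1⟩
  by_cases hvL : v ∈ L
  · exact Finset.eq_of_subset_of_card_le hLK (hmin L ⟨hvL, hLT⟩)
  · have h1 := hmin (K \ L) ⟨Finset.mem_sdiff.2 ⟨hK.1, hvL⟩, hK.2.sdiff hLT⟩
    have h2 := Finset.card_sdiff_add_card_eq_card hLK
    have h3 := hL.card_pos
    omega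

/-- The vertex sets of the components of `G - T`. -/
noncomputable def comps (G : SimpleGraph V) (T : Finset V) : Finset (Finset V) :=
  Finset.univ.filter (IsComp G T)

/-- The vertex sets of the components of `G - T` of odd order. -/
noncomputable def oddComps (G : SimpleGraph V) (T : Finset V) : Finset (Finset V) :=
  (comps G T).filter fun K => Odd K.card

@[simp]
lemma mem_comps : K ∈ comps G T ↔ IsComp G T K := by
  simp [comps]

@[simp]
lemma mem_oddComps : K ∈ oddComps G T ↔ IsComp G T K ∧ Odd K.card := by
  simp [oddComps]

lemma pairwiseDisjoint_comps (G : SimpleGraph V) (T : Finset V) :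
    (comps G T : Set (Finset V)).PairwiseDisjoint id := by
  intro K hK L hL hne
  refine Finset.disjoint_left.2 fun v hvK hvL => hne ?_
  exact (mem_comps.1 hK).eq_of_mem (mem_comps.1 hL) hvK hvL

lemma biUnion_comps (G : SimpleGraph V) (T : Finset V) : (comps G T).biUnion id = Tᶜ := by
  ext v
  simp only [Finset.mem_biUnion, mem_comps, id, Finset.mem_compl]
  exact ⟨fun ⟨K, hK, hv⟩ => hK.notMem hv, exists_isComp_of_notMem G⟩

lemma even_card_oddComps_add_card (hV : Even (Fintype.card V)) (G : SimpleGraph V)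
    (T : Finset V) : Even ((oddComps G T).card + T.card) := by
  have h1 : (Tᶜ).card = ∑ K ∈ comps G T, K.card := by
    rw [← biUnion_comps G T, Finset.card_biUnion (pairwiseDisjoint_comps G T)]
    rfl
  have h2 := Finset.odd_sum_iff_odd_card_odd (s := comps G T) Finset.card
  rw [← h1] at h2
  have h3 := Finset.card_add_card_compl T
  rw [← h3, Nat.even_add, ← Nat.not_odd_iff_even (n := (Tᶜ).card), h2] at hV
  rw [Nat.even_add, hV, ← Nat.not_odd_iff_even]
  rfl

/-- The odd components of a copy `H` of `G - T` correspond to the sets in `oddComps G T`. -/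
lemma ncard_oddComponents_eq {W : Type*} [Finite W] (H : SimpleGraph W) (i : W → V)
    (hi : Function.Injective i) (hT : ∀ v, v ∉ T ↔ v ∈ Set.range i)
    (hadj : ∀ a b, H.Adj a b ↔ G.Adj (i a) (i b)) :
    H.oddComponents.ncard = (oddComps G T).card := by
  have : Fintype W := Fintype.ofFinite W
  let φ : H.ConnectedComponent → Finset V := fun c => (Finset.univ.filter (· ∈ c.supp)).image i
  have hmem (c : H.ConnectedComponent) (w : W) : i w ∈ φ c ↔ H.connectedComponentMk w = c := by
    simp [φ, hi.eq_iff]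
  have hex (c : H.ConnectedComponent) (v : V) (hv : v ∈ φ c) : ∃ w, i w = v := by
    simp only [φ, Finset.mem_image] at hv
    exact hv.imp fun w hw => hw.2
  have hclosed (c : H.ConnectedComponent) : IsClosedOff G T (φ c) := by
    refine ⟨Finset.disjoint_left.2 fun v hv => ?_, fun a ha b hab hb => ?_⟩
    · exact (hT v).2 (hex c v hv)
    · obtain ⟨a, rfl⟩ := hex c a ha
      obtain ⟨b, rfl⟩ := (hT b).1 hb
      rw [hmem] at ha ⊢
      rw [← ha, SimpleGraph.ConnectedComponent.eq]
      exact ((hadj a b).2 hab).symm.reachable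
  have hreach (L : Finset V) (hL : IsClosedOff G T L) (a b : W) (hab : H.Reachable a b)
      (ha : i a ∈ L) : i b ∈ L := by
    obtain ⟨p⟩ := hab
    induction p with
    | nil => exact ha
    | cons h p ih => exact ih (hL.2 _ ha _ ((hadj _ _).1 h) ((hT _).2 ⟨_, rfl⟩))
  have hcomp (c : H.ConnectedComponent) : IsComp G T (φ c) := by
    refine ⟨?_, hclosed c, fun L hLc hL hLT => hLc.antisymm fun v hv => ?_⟩
    · obtain ⟨w, hw⟩ := c.nonempty_supp
      exact ⟨i w, (hmem c w).2 hw⟩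
    · obtain ⟨u, hu⟩ := hL
      obtain ⟨a, rfl⟩ := hex c u (hLc hu)
      obtain ⟨b, rfl⟩ := hex c v hv
      refine hreach L hLT a b (SimpleGraph.ConnectedComponent.eq.1 ?_) hu
      rw [(hmem c a).1 (hLc hu), (hmem c b).1 hv]
  have hcard (c : H.ConnectedComponent) : (φ c).card = c.supp.ncard := by
    rw [Finset.card_image_of_injective _ hi, ← Set.ncard_coe_finset]
    congr 1
    ext
    simp
  rw [← Set.ncard_coe_finset]
  refine Set.ncard_congr (fun c _ => φ c) (fun c hc => ?_) (fun c d _ _ h => ?_) fun K hK => ?_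
  · rw [Finset.mem_coe, mem_oddComps, hcard]
    exact ⟨hcomp c, hc⟩
  · obtain ⟨w, hw⟩ := c.nonempty_supp
    have h1 := (hmem c w).2 hw
    have h2 : i w ∈ φ d := h ▸ h1
    rw [← (hmem c w).1 h1, (hmem d w).1 h2]
  · rw [Finset.mem_coe, mem_oddComps] at hK
    obtain ⟨v, hv⟩ := hK.1.1
    obtain ⟨w, rfl⟩ := (hT v).1 (hK.1.notMem hv)
    have h := (hcomp (H.connectedComponentMk w)).eq_of_mem hK.1 ((hmem _ w).2 rfl) hv
    refine ⟨H.connectedComponentMk w, ?_, h⟩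
    change Odd _
    rw [← hcard, h]
    exact hK.2

lemma card_oddComps_eq_oddComp (G : SimpleGraph V) (T : Finset V) :
    (oddComps G T).card = oddComp G (T : Set V) := by
  rw [oddComp, ← ncard_oddComponents_eq (G := G) (T := T) (G.induce (T : Set V)ᶜ) Subtype.val
    Subtype.val_injective (by simp) (by simp)]
  rfl

lemma card_lt_card_oddComps {u : Finset V} (h : G.IsTutteViolator (u : Set V)) :
    u.card < (oddComps G u).card := by
  rw [IsTutteViolator, Set.ncard_coe_finset,
    ncard_oddComponents_eq (G := G) (T := u) _ Subtype.val Subtype.val_injective (by simp)] at h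
  · exact h
  · rintro ⟨a, ha⟩ ⟨b, hb⟩
    simp at ha hb
    simp [ha, hb]

end Components

section Blowup

open scoped Classical

variable {V : Type*} {G : SimpleGraph V} {g : V → ℕ}

/-- The graph obtained from `G` by replacing each vertex `v` with a clique on `g v` vertices. -/
def blowup (G : SimpleGraph V) (g : V → ℕ) : SimpleGraph (Σ v, Fin (g v)) where
  Adj p q := p ≠ q ∧ (p.1 = q.1 ∨ G.Adj p.1 q.1)
  symm := ⟨fun _ _ h => ⟨h.1.symm, h.2.imp Eq.symm SimpleGraph.Adj.symm⟩⟩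
  loopless := ⟨fun _ h => h.1 rfl⟩

/-- The vertices all of whose copies in the blow-up lie in `u`. -/
noncomputable def fullVertices [Fintype V] (u : Finset (Σ v, Fin (g v))) : Finset V :=
  Finset.univ.filter fun v => ∀ i, (⟨v, i⟩ : Σ v, Fin (g v)) ∈ u

lemma mem_fullVertices [Fintype V] {u : Finset (Σ v, Fin (g v))} {v : V} :
    v ∈ fullVertices u ↔ ∀ i, (⟨v, i⟩ : Σ v, Fin (g v)) ∈ u := by
  simp [fullVertices]

lemma IsComp.mem_of_fst_mem_image {u K : Finset (Σ v, Fin (g v))} (hK : IsComp (blowup G g) u K)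
    {p : Σ v, Fin (g v)} (hp : p.1 ∈ K.image Sigma.fst) (hpu : p ∉ u) : p ∈ K := by
  obtain ⟨q, hq, hqp⟩ := Finset.mem_image.1 hp
  by_cases h : q = p
  · exact h ▸ hq
  · exact hK.2.1.2 q hq p ⟨h, Or.inl hqp⟩ hpu

variable [Fintype V]

lemma IsComp.image_fst {u K : Finset (Σ v, Fin (g v))} (hK : IsComp (blowup G g) u K) :
    IsComp G (fullVertices u) (K.image Sigma.fst) := by
  refine ⟨hK.1.image _, ⟨Finset.disjoint_left.2 fun v hv hvu => ?_, fun a ha b hab hb => ?_⟩,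
    fun L hLK hL hLu => hLK.antisymm fun v hv => ?_⟩
  · obtain ⟨p, hp, rfl⟩ := Finset.mem_image.1 hv
    exact hK.notMem hp (mem_fullVertices.1 hvu p.2)
  · obtain ⟨p, hp, rfl⟩ := Finset.mem_image.1 ha
    rw [mem_fullVertices] at hb
    push Not at hb
    obtain ⟨i, hi⟩ := hb
    refine Finset.mem_image.2 ⟨⟨b, i⟩, hK.2.1.2 p hp _ ⟨?_, Or.inr hab⟩ hi, rfl⟩
    rintro rfl
    exact G.loopless.irrefl _ hab
  · have h := hK.2.2 (K.filter fun p => p.1 ∈ L) (Finset.filter_subset _ _) ?_ ⟨?_, ?_⟩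
    · obtain ⟨p, hp, rfl⟩ := Finset.mem_image.1 hv
      rw [← h] at hp
      exact (Finset.mem_filter.1 hp).2
    · obtain ⟨w, hw⟩ := hL
      obtain ⟨p, hp, rfl⟩ := Finset.mem_image.1 (hLK hw)
      exact ⟨p, Finset.mem_filter.2 ⟨hp, hw⟩⟩
    · exact hK.2.1.1.mono_left (Finset.filter_subset _ _)
    · intro p hp q hpq hq
      rw [Finset.mem_filter] at hp ⊢
      refine ⟨hK.2.1.2 p hp.1 q hpq hq, ?_⟩
      rcases hpq.2 with h | h
      · exact h ▸ hp.2
      · exact hLu.2 _ hp.2 _ h fun hf => hq (mem_fullVertices.1 hf q.2)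

lemma card_filter_fst_mem [DecidableEq V] (g : V → ℕ) (K : Finset V) :
    (Finset.univ.filter fun p : Σ v, Fin (g v) => p.1 ∈ K).card = ∑ v ∈ K, g v := by
  have h : (Finset.univ.filter fun p : Σ v, Fin (g v) => p.1 ∈ K) =
      K.sigma fun v => (Finset.univ : Finset (Fin (g v))) := by
    ext
    simp
  rw [h, Finset.card_sigma]
  simp

lemma IsComp.card_add_card {u K : Finset (Σ v, Fin (g v))} (hK : IsComp (blowup G g) u K) :
    K.card + (u.filter fun p => p.1 ∈ K.image Sigma.fst).card =
      ∑ v ∈ K.image Sigma.fst, g v := by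
  rw [← card_filter_fst_mem, ← Finset.card_union_of_disjoint]
  · congr 1
    ext p
    rw [Finset.mem_union, Finset.mem_filter, Finset.mem_filter_univ]
    constructor
    · rintro (h | h)
      · exact Finset.mem_image_of_mem _ h
      · exact h.2
    · intro h
      by_cases hp : p ∈ u
      · exact Or.inr ⟨hp, h⟩
      · exact Or.inl (hK.mem_of_fst_mem_image h hp)
  · exact hK.2.1.1.mono_right (Finset.filter_subset _ _)

lemma card_oddComps_blowup_le (h : ∀ T : Finset V, (∀ v, g v = 0 → v ∈ T) →
      ((comps G T).filter fun K => Odd (∑ v ∈ K, g v)).card ≤ ∑ v ∈ T, g v)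
    (u : Finset (Σ v, Fin (g v))) : (oddComps (blowup G g) u).card ≤ u.card := by
  let T : Finset V := fullVertices u
  let r : Finset V → ℕ := fun K => (u.filter fun p => p.1 ∈ K).card
  have h1 : (oddComps (blowup G g) u).card ≤
      (((comps G T).filter fun K => Odd (∑ v ∈ K, g v)) ∪
        (comps G T).filter fun K => 0 < r K).card := by
    refine Finset.card_le_card_of_injOn (fun K => K.image Sigma.fst) (fun K hK => ?_)
      fun K hK L hL hKL => ?_
    · rw [Finset.mem_coe, mem_oddComps] at hK
      have hcomp := hK.1.image_fst
      have hcard := hK.1.card_add_card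
      rw [Finset.mem_coe, Finset.mem_union, Finset.mem_filter, Finset.mem_filter, mem_comps]
      rcases Nat.eq_zero_or_pos (r (K.image Sigma.fst)) with h0 | h0
      · refine Or.inl ⟨hcomp, ?_⟩
        rw [← hcard]
        change Odd (_ + r _)
        rw [h0]
        exact hK.2
      · exact Or.inr ⟨hcomp, h0⟩
    · rw [Finset.mem_coe, mem_oddComps] at hK hL
      obtain ⟨p, hp⟩ := hK.1.1
      refine hK.1.eq_of_mem hL.1 hp (hL.1.mem_of_fst_mem_image ?_ (hK.1.notMem hp))
      beta_reduce at hKL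
      rw [← hKL]
      exact Finset.mem_image_of_mem _ hp
  have h2 := h T fun v hv => mem_fullVertices.2 fun i => (Fin.cast hv i).elim0
  have h3 : ((comps G T).filter fun K => 0 < r K).card ≤ ∑ K ∈ comps G T, r K := by
    rw [Finset.card_filter]
    exact Finset.sum_le_sum fun K _ => by split_ifs <;> omega
  have h4 : ∑ K ∈ comps G T, r K ≤ (u.filter fun p => p.1 ∉ T).card := by
    rw [← Finset.card_biUnion]
    · refine Finset.card_le_card fun p hp => ?_
      obtain ⟨K, hK, hp⟩ := Finset.mem_biUnion.1 hp
      rw [Finset.mem_filter] at hp ⊢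
      exact ⟨hp.1, (mem_comps.1 hK).notMem hp.2⟩
    · intro K hK L hL hne
      refine Finset.disjoint_left.2 fun p hpK hpL => hne ?_
      exact (mem_comps.1 hK).eq_of_mem (mem_comps.1 hL) (Finset.mem_filter.1 hpK).2
        (Finset.mem_filter.1 hpL).2
  have h5 : (u.filter fun p => p.1 ∈ T).card = ∑ v ∈ T, g v := by
    rw [← card_filter_fst_mem]
    congr 1
    ext p
    rw [Finset.mem_filter, Finset.mem_filter_univ, and_iff_right_iff_imp]
    exact fun hp => mem_fullVertices.1 hp p.2
  have h6 := Finset.card_filter_add_card_filter_not (s := u) fun p => p.1 ∈ T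
  have h7 := Finset.card_union_le ((comps G T).filter fun K => Odd (∑ v ∈ K, g v))
    ((comps G T).filter fun K => 0 < r K)
  omega

lemma ndeg_eq_card (F : SimpleGraph V) (v : V) :
    ndeg F v = (Finset.univ.filter fun w => F.Adj v w).card := by
  rw [ndeg, Nat.card_eq_fintype_card, ← Set.toFinset_card]
  congr 1
  ext
  simp

/-- A parity analogue of Tutte's theorem: `G` has a subgraph whose degrees are bounded by `g` and
have the same parity as `g`. -/
theorem exists_parity_factor (h : ∀ T : Finset V, (∀ v, g v = 0 → v ∈ T) →
      ((comps G T).filter fun K => Odd (∑ v ∈ K, g v)).card ≤ ∑ v ∈ T, g v) :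
    ∃ F ≤ G, ∀ v, ndeg F v ≤ g v ∧ (Odd (ndeg F v) ↔ Odd (g v)) := by
  obtain ⟨M, hM⟩ : ∃ M : (blowup G g).Subgraph, M.IsPerfectMatching := by
    refine tutte.2 fun u hu => ?_
    rw [← Set.Finite.coe_toFinset u.toFinite] at hu
    exact absurd (card_oddComps_blowup_le h u.toFinite.toFinset)
      (not_le.2 (card_lt_card_oddComps hu))
  rw [Subgraph.isPerfectMatching_iff] at hM
  choose σ hσ hσ' using hM
  have hinv (p) : σ (σ p) = p := (hσ' _ _ (hσ p).symm).symm
  let m : V → V → ℕ := fun v w => (Finset.univ.filter fun p => p.1 = v ∧ (σ p).1 = w).card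
  have hsymm (v w : V) : m v w = m w v := by
    refine Finset.card_bij' (fun p _ => σ p) (fun p _ => σ p) ?_ ?_ ?_ ?_ <;>
      simp +contextual [hinv]
  have hdiag (v : V) : Even (m v v) := by
    change Even (Finset.card _)
    rw [← ZMod.natCast_eq_zero_iff_even, Finset.card_eq_sum_ones, Nat.cast_sum, Nat.cast_one]
    refine Finset.sum_involution (fun p _ => σ p) (fun _ _ => by decide) (fun p _ _ hp => ?_)
      (fun p hp => ?_) fun p _ => hinv p
    · exact (M.adj_sub (hσ p)).1 hp.symm
    · rw [Finset.mem_filter_univ] at hp ⊢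
      rw [hinv]
      exact hp.symm
  have hsum (v : V) : ∑ w, m v w = g v := by
    have h1 := card_filter_fst_mem g {v}
    rw [Finset.sum_singleton] at h1
    rw [← h1, Finset.card_eq_sum_card_fiberwise (f := fun p => (σ p).1) (t := Finset.univ)
      fun _ _ => Finset.mem_coe.2 (Finset.mem_univ _)]
    refine Finset.sum_congr rfl fun w _ => ?_
    rw [Finset.filter_filter]
    simp [m]
  obtain ⟨F, hF⟩ : ∃ F : SimpleGraph V, ∀ v w, F.Adj v w ↔ Odd (m v w) :=
    ⟨⟨fun v w => Odd (m v w), ⟨fun v w hvw => by rwa [hsymm]⟩,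
      ⟨fun v hv => Nat.not_odd_iff_even.2 (hdiag v) hv⟩⟩, fun _ _ => Iff.rfl⟩
  refine ⟨F, fun v w hvw => ?_, fun v => ?_⟩
  · rw [hF] at hvw
    obtain ⟨p, hp⟩ := Finset.card_pos.1 hvw.pos
    obtain ⟨rfl, rfl⟩ := (Finset.mem_filter_univ p).1 hp
    refine (M.adj_sub (hσ p)).2.resolve_left fun heq => ?_
    rw [← heq] at hvw
    exact Nat.not_odd_iff_even.2 (hdiag _) hvw
  · simp only [ndeg_eq_card, hF]
    rw [← Finset.odd_sum_iff_odd_card_odd, hsum, ← hsum v, Finset.card_filter]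
    exact ⟨Finset.sum_le_sum fun w _ => by split_ifs with hw <;> [exact hw.pos; omega], Iff.rfl⟩

end Blowup

section Assignment

open scoped Classical

/-- Combining the two Hall conditions of a bipartite relation: if each `a` can receive `f a - 1`
private neighbours and all `b` can be assigned so that each `a` receives at most `f a`, then both
can be achieved at once. -/
lemma exists_assignment {α β : Type*} [Fintype α] [DecidableEq α] [Fintype β] (R : α → β → Prop)
    (f : α → ℕ)
    (hα : ∀ Y : Finset α, ∑ a ∈ Y, (f a - 1) ≤ (Finset.univ.filter fun b => ∃ a ∈ Y, R a b).card)
    (hβ : ∀ X : Finset β, X.card ≤ ∑ a with ∃ b ∈ X, R a b, f a) :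
    ∃ φ : β → α, (∀ b, R (φ b) b) ∧
      ∀ a, f a - 1 ≤ (Finset.univ.filter fun b => φ b = a).card ∧
        (Finset.univ.filter fun b => φ b = a).card ≤ f a := by
  have hle : Fintype.card β ≤ ∑ a, f a :=
    (hβ Finset.univ).trans (Finset.sum_le_sum_of_subset (Finset.filter_subset _ _))
  obtain ⟨N, hN⟩ := Nat.exists_eq_add_of_le hle
  let nbr : (Σ a, Fin (f a)) → Finset (β ⊕ Fin N) := fun p =>
    (Finset.univ.filter fun b => R p.1 b).disjSum
      (Finset.univ.filter fun _ => (p.2 : ℕ) + 1 = f p.1)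
  obtain ⟨e, he, hnbr⟩ := (Finset.all_card_le_biUnion_card_iff_exists_injective nbr).1 fun Z => by
    let Y : Finset α := Z.image Sigma.fst
    let B : Finset β := Finset.univ.filter fun b => ∃ a ∈ Y, R a b
    by_cases hZ : ∃ p ∈ Z, (p.2 : ℕ) + 1 = f p.1
    · obtain ⟨p, hpZ, hp⟩ := hZ
      have h1 : B.disjSum Finset.univ ⊆ Z.biUnion nbr := by
        rintro (b | i) hb
        · simp only [B, Y, Finset.inl_mem_disjSum, Finset.mem_filter_univ, Finset.mem_image] at hb
          obtain ⟨_, ⟨q, hq, rfl⟩, hqb⟩ := hb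
          exact Finset.mem_biUnion.2 ⟨q, hq, by simpa [nbr] using hqb⟩
        · exact Finset.mem_biUnion.2 ⟨p, hpZ, by simp [nbr, hp]⟩
      have h2 := Finset.card_le_card h1
      rw [Finset.card_disjSum, Finset.card_univ, Fintype.card_fin] at h2
      have h3 := hβ Bᶜ
      have h4 : Finset.univ.filter (fun a => ∃ b ∈ Bᶜ, R a b) ⊆ Yᶜ := fun a ha => by
        simp only [B, Finset.mem_filter_univ, Finset.mem_compl] at ha ⊢
        obtain ⟨b, hb, hab⟩ := ha
        exact fun haY => hb ⟨a, haY, hab⟩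
      have h5 := Finset.sum_le_sum_of_subset (f := f) h4
      have h6 := Finset.sum_add_sum_compl Y f
      have h7 := Finset.card_add_card_compl B
      have h8 : Z.card ≤ ∑ a ∈ Y, f a := by
        rw [← card_filter_fst_mem]
        exact Finset.card_le_card fun q hq =>
          (Finset.mem_filter_univ q).2 (Finset.mem_image_of_mem _ hq)
      omega
    · push Not at hZ
      have h1 : B.map ⟨Sum.inl, Sum.inl_injective⟩ ⊆ Z.biUnion nbr := fun b hb => by
        obtain ⟨c, hc, rfl⟩ := Finset.mem_map.1 hb
        simp only [B, Y, Finset.mem_filter_univ, Finset.mem_image] at hc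
        obtain ⟨_, ⟨q, hq, rfl⟩, hqc⟩ := hc
        exact Finset.mem_biUnion.2 ⟨q, hq, by simpa [nbr] using hqc⟩
      have h2 := Finset.card_le_card h1
      rw [Finset.card_map] at h2
      have h3 : Z.card ≤ ∑ a ∈ Y, (f a - 1) := by
        rw [Finset.card_eq_sum_card_image Sigma.fst]
        refine Finset.sum_le_sum fun a _ => ?_
        refine (Finset.card_le_card_of_injOn (fun p => (p.2 : ℕ)) (t := Finset.range (f a - 1))
          (fun p hp => ?_) fun p hp q hq hpq => ?_).trans (Finset.card_range _).le
        · obtain ⟨hpZ, rfl⟩ := Finset.mem_filter.1 hp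
          have := hZ p hpZ
          have := p.2.2
          simp only [Finset.coe_range, Set.mem_Iio]
          omega
        · have h1 := (Finset.mem_filter.1 hp).2
          have h2 := (Finset.mem_filter.1 hq).2
          exact Sigma.ext (h1.trans h2.symm) ((Fin.heq_ext_iff (by rw [h1, h2])).2 hpq)
      exact h3.trans ((hα Y).trans h2)
  have hbij : Function.Bijective e := by
    rw [Fintype.bijective_iff_injective_and_card]
    refine ⟨he, ?_⟩
    simp [hN]
  choose ψ hψ using fun b => hbij.2 (Sum.inl b)
  have hψinj : Function.Injective ψ := fun b c hbc => by
    rw [← Sum.inl.injEq, ← hψ b, ← hψ c, hbc]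
  refine ⟨fun b => (ψ b).1, fun b => ?_, fun a => ⟨?_, ?_⟩⟩
  · have h := hnbr (ψ b)
    rw [hψ] at h
    simpa [nbr] using h
  · have hinl (i : Fin (f a - 1)) : ∃ b, ψ b = ⟨a, i.castLE (Nat.sub_le _ _)⟩ := by
      have h := hnbr ⟨a, i.castLE (Nat.sub_le _ _)⟩
      rcases hei : e ⟨a, i.castLE (Nat.sub_le _ _)⟩ with b | k
      · exact ⟨b, he ((hψ b).trans hei.symm)⟩
      · rw [hei] at h
        have h1 : (i : ℕ) + 1 = f a := by
          have h2 := (Finset.mem_filter.1 (Finset.inr_mem_disjSum.1 h)).2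
          exact h2
        have := i.2
        omega
    choose b hb using hinl
    rw [← Fintype.card_fin (f a - 1), ← Finset.card_univ]
    refine Finset.card_le_card_of_injOn b (fun i _ => ?_) fun i _ j _ hij => ?_
    · rw [Finset.mem_coe, Finset.mem_filter_univ]
      beta_reduce
      rw [hb]
    · have h := hb i
      rw [hij, hb j] at h
      simpa [Fin.ext_iff, eq_comm] using h
  · have h := card_filter_fst_mem f {a}
    rw [Finset.sum_singleton] at h
    rw [← h]
    refine Finset.card_le_card_of_injOn ψ (fun b hb => ?_) hψinj.injOn
    rw [Finset.mem_coe, Finset.mem_filter_univ] at hb ⊢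
    exact Finset.mem_singleton.2 hb

end Assignment

section Barrier

open scoped Classical

variable {V : Type*} {G : SimpleGraph V} {S T C R : Finset V} {w : V → ℕ}

lemma IsComp.isComp_union_of_ne {K : Finset V} (hK : IsComp G S K) (hC : IsComp G S C)
    (hne : K ≠ C) (hT : T ⊆ C) : IsComp G (S ∪ T) K := by
  have hKT : Disjoint K T := Finset.disjoint_left.2 fun v hv hvT => hne (hK.eq_of_mem hC hv (hT hvT))
  refine hK.congr (Finset.disjoint_union_right.2 ⟨hK.2.1.1, hKT⟩) fun a ha b hab => ?_
  rw [Finset.mem_union, iff_self_or]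
  intro hb
  by_contra hbS
  exact Finset.disjoint_left.1 hKT (hK.2.1.2 a ha b hab hbS) hb

/-- The function `w`, set to zero on `S` and decreased by one on `R`. -/
noncomputable def reducedBound (w : V → ℕ) (S R : Finset V) (v : V) : ℕ :=
  if v ∈ S then 0 else w v - if v ∈ R then 1 else 0

lemma sum_reducedBound_add (hw : ∀ v, Odd (w v)) {K : Finset V} (hK : Disjoint K S) :
    ∑ v ∈ K, reducedBound w S R v + (K ∩ R).card = ∑ v ∈ K, w v := by
  rw [← Finset.filter_mem_eq_inter, Finset.card_filter, ← Finset.sum_add_distrib]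
  refine Finset.sum_congr rfl fun v hv => ?_
  have := (hw v).pos
  rw [reducedBound, if_neg (Finset.disjoint_left.1 hK hv)]
  split_ifs <;> omega

lemma odd_sum_iff_odd_card (hw : ∀ v, Odd (w v)) (K : Finset V) :
    Odd (∑ v ∈ K, w v) ↔ Odd K.card := by
  rw [Finset.odd_sum_iff_odd_card_odd, Finset.filter_true_of_mem fun v _ => hw v]

lemma odd_sum_reducedBound_iff (hw : ∀ v, Odd (w v)) {K : Finset V} (hK : Disjoint K S) :
    Odd (∑ v ∈ K, reducedBound w S R v) ↔ (Odd K.card ↔ Even (K ∩ R).card) := by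
  rw [← odd_sum_iff_odd_card hw, ← sum_reducedBound_add (R := R) hw hK, Nat.odd_add]
  tauto

variable [Fintype V]

/-- `S` is an inclusion-maximal maximizer of `o(G - S) - w(S)`. -/
def IsExtremeBarrier (G : SimpleGraph V) (w : V → ℕ) (S : Finset V) : Prop :=
  ∀ T, (oddComps G T).card + ∑ v ∈ S, w v ≤ (oddComps G S).card + ∑ v ∈ T, w v ∧
    (S ⊂ T → (oddComps G T).card + ∑ v ∈ S, w v < (oddComps G S).card + ∑ v ∈ T, w v)

lemma exists_isExtremeBarrier (G : SimpleGraph V) (w : V → ℕ) : ∃ S, IsExtremeBarrier G w S := by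
  let q : Finset V → ℤ := fun T => ((oddComps G T).card : ℤ) - ((∑ v ∈ T, w v : ℕ) : ℤ)
  obtain ⟨S, -, hS⟩ := Finset.exists_max_image Finset.univ
    (fun T : Finset V => ((Fintype.card V : ℤ) + 1) * q T + T.card) Finset.univ_nonempty
  refine ⟨S, fun T => ?_⟩
  have h1 := hS T (Finset.mem_univ _)
  have h2 : (S.card : ℤ) ≤ Fintype.card V := by exact_mod_cast Finset.card_le_univ S
  have h3 : q T ≤ q S := by
    by_contra! h
    nlinarith
  refine ⟨by simp only [q] at h3; omega, fun hST => ?_⟩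
  have h4 : (S.card : ℤ) < T.card := by exact_mod_cast Finset.card_lt_card hST
  have h5 : q T < q S := by
    by_contra! h
    nlinarith
  simp only [q] at h5
  omega

/-- Splitting one component `C` of `G - S` by `T ⊆ C` keeps the other odd components. -/
lemma card_filter_comps_add_le (hC : IsComp G S C) (hT : T ⊆ C) :
    ((comps G (S ∪ T)).filter fun K => K ⊆ C ∧ Odd K.card).card + (oddComps G S).card ≤
      (oddComps G (S ∪ T)).card + if Odd C.card then 1 else 0 := by
  have h1 : (oddComps G S).card ≤ ((oddComps G S).erase C).card + if Odd C.card then 1 else 0 := by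
    split_ifs with h
    · rw [Finset.card_erase_add_one (mem_oddComps.2 ⟨hC, h⟩)]
    · rw [Finset.erase_eq_of_notMem fun h' => h (mem_oddComps.1 h').2, add_zero]
  have h2 : Disjoint ((comps G (S ∪ T)).filter fun K => K ⊆ C ∧ Odd K.card)
      ((oddComps G S).erase C) := by
    refine Finset.disjoint_left.2 fun K hK hK' => ?_
    rw [Finset.mem_filter] at hK
    rw [Finset.mem_erase, mem_oddComps] at hK'
    obtain ⟨v, hv⟩ := hK'.2.1.1
    exact hK'.1 (hK'.2.1.eq_of_mem hC hv (hK.2.1 hv))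
  have h3 : ((comps G (S ∪ T)).filter fun K => K ⊆ C ∧ Odd K.card) ∪ (oddComps G S).erase C ⊆
      oddComps G (S ∪ T) := by
    refine Finset.union_subset (fun K hK => ?_) fun K hK => ?_
    · rw [Finset.mem_filter, mem_comps] at hK
      exact mem_oddComps.2 ⟨hK.1, hK.2.2⟩
    · rw [Finset.mem_erase, mem_oddComps] at hK
      exact mem_oddComps.2 ⟨hK.2.1.isComp_union_of_ne hC hK.1 hT, hK.2.2⟩
  have h4 := Finset.card_le_card h3
  rw [Finset.card_union_of_disjoint h2] at h4
  omega

lemma IsExtremeBarrier.card_filter_le (hS : IsExtremeBarrier G w S) (hV : Even (Fintype.card V))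
    (hw : ∀ v, Odd (w v)) (hC : IsComp G S C) (hT : T ⊆ C)
    (hR : (C ∩ R).card = if Odd C.card then 1 else 0) :
    ((comps G (S ∪ T)).filter fun K => K ⊆ C ∧ Odd (∑ v ∈ K, reducedBound w S R v)).card ≤
      ∑ v ∈ T, reducedBound w S R v := by
  have hTS : Disjoint T S := hC.2.1.1.mono_left hT
  rcases T.eq_empty_or_nonempty with rfl | hne
  · rw [Finset.union_empty, Finset.sum_empty, Nat.le_zero, Finset.card_eq_zero,
      Finset.filter_eq_empty_iff]
    rintro K hK ⟨hKC, hodd⟩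
    obtain rfl := hC.2.2 K hKC (mem_comps.1 hK).1 (mem_comps.1 hK).2.1
    rw [odd_sum_reducedBound_iff hw hC.2.1.1, hR] at hodd
    split_ifs at hodd with h <;> simp [h] at hodd
  have hsplit := card_filter_comps_add_le hC hT
  rw [← hR] at hsplit
  have hcount : ((comps G (S ∪ T)).filter fun K => K ⊆ C ∧
      Odd (∑ v ∈ K, reducedBound w S R v)).card + (T ∩ R).card ≤
      ((comps G (S ∪ T)).filter fun K => K ⊆ C ∧ Odd K.card).card + (C ∩ R).card := by
    let D := (comps G (S ∪ T)).filter fun K => K ⊆ C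
    have h1 : ((comps G (S ∪ T)).filter fun K => K ⊆ C ∧
        Odd (∑ v ∈ K, reducedBound w S R v)).card ≤
        ((comps G (S ∪ T)).filter fun K => K ⊆ C ∧ Odd K.card).card +
          ∑ K ∈ D, (K ∩ R).card := by
      rw [← Finset.filter_filter, ← Finset.filter_filter, Finset.card_filter, Finset.card_filter,
        ← Finset.sum_add_distrib]
      refine Finset.sum_le_sum fun K hK => ?_
      have hKS : Disjoint K S := hC.2.1.1.mono_left (Finset.mem_filter.1 hK).2
      have hiff := odd_sum_reducedBound_iff (R := R) hw hKS
      rcases Nat.eq_zero_or_pos (K ∩ R).card with h0 | h0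
      · simp only [h0, Even.zero, iff_true] at hiff
        simp [h0, hiff]
      · split_ifs <;> omega
    have h2 : ∑ K ∈ D, (K ∩ R).card ≤ ((C \ T) ∩ R).card := by
      rw [← Finset.card_biUnion]
      · refine Finset.card_le_card fun v hv => ?_
        simp only [D, Finset.mem_biUnion, Finset.mem_filter, mem_comps, Finset.mem_inter] at hv
        obtain ⟨K, ⟨hK, hKC⟩, hvK, hvR⟩ := hv
        have := hK.notMem hvK
        rw [Finset.mem_union, not_or] at this
        exact Finset.mem_inter.2 ⟨Finset.mem_sdiff.2 ⟨hKC hvK, this.2⟩, hvR⟩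
      · intro K hK L hL hne
        have := pairwiseDisjoint_comps G (S ∪ T) (Finset.filter_subset _ _ hK)
          (Finset.filter_subset _ _ hL) hne
        exact this.mono Finset.inter_subset_left Finset.inter_subset_left
    have h3 : ((C \ T) ∩ R).card + (T ∩ R).card = (C ∩ R).card := by
      rw [← Finset.card_union_of_disjoint
        (Finset.sdiff_disjoint.mono Finset.inter_subset_left Finset.inter_subset_left),
        ← Finset.union_inter_distrib_right, Finset.sdiff_union_of_subset hT]
    omega
  have hlt := (hS (S ∪ T)).2 <| by
    refine Finset.ssubset_iff_subset_ne.2 ⟨Finset.subset_union_left, fun h => ?_⟩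
    obtain ⟨v, hv⟩ := hne
    exact Finset.disjoint_left.1 hTS hv (h ▸ Finset.mem_union_right _ hv)
  rw [Finset.sum_union hTS.symm] at hlt
  have hsum := sum_reducedBound_add (R := R) hw hTS
  have hp1 := even_card_oddComps_add_card hV G S
  have hp2 := even_card_oddComps_add_card hV G (S ∪ T)
  rw [Finset.card_union_of_disjoint hTS.symm] at hp2
  have hp3 := odd_sum_iff_odd_card hw T
  have hle : (C ∩ R).card ≤ 1 := by
    rw [hR]
    split_ifs <;> omega
  rw [Nat.odd_iff, Nat.odd_iff] at hp3
  rw [Nat.even_iff] at hp1 hp2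
  omega

lemma IsExtremeBarrier.exists_parity_factor (hS : IsExtremeBarrier G w S)
    (hV : Even (Fintype.card V)) (hw : ∀ v, Odd (w v))
    (hR : ∀ C, IsComp G S C → (C ∩ R).card = if Odd C.card then 1 else 0) :
    ∃ F ≤ G, ∀ v, ndeg F v ≤ reducedBound w S R v ∧
      (Odd (ndeg F v) ↔ Odd (reducedBound w S R v)) := by
  refine _root_.exists_parity_factor fun T hT => ?_
  have hST : S ⊆ T := fun v hv => hT v (if_pos hv)
  have h1 : (comps G T).filter (fun K => Odd (∑ v ∈ K, reducedBound w S R v)) ⊆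
      (comps G S).biUnion fun C => (comps G (S ∪ T ∩ C)).filter fun K =>
        K ⊆ C ∧ Odd (∑ v ∈ K, reducedBound w S R v) := by
    intro K hK
    rw [Finset.mem_filter, mem_comps] at hK
    obtain ⟨hK, hodd⟩ := hK
    obtain ⟨v, hv⟩ := hK.1
    obtain ⟨C, hC, hvC⟩ := exists_isComp_of_notMem (T := S) G fun h => hK.notMem hv (hST h)
    have hKC := hC.subset_of_mem hK hST hvC hv
    refine Finset.mem_biUnion.2 ⟨C, mem_comps.2 hC, Finset.mem_filter.2 ⟨mem_comps.2 ?_, hKC, hodd⟩⟩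
    refine hK.congr (hK.2.1.1.mono_right ?_) fun a ha b hab => ?_
    · exact Finset.union_subset hST Finset.inter_subset_left
    · rw [Finset.mem_union, Finset.mem_inter]
      have := hC.2.1.2 a (hKC ha) b hab
      have := @hST b
      tauto
  calc _ ≤ _ := Finset.card_le_card h1
    _ ≤ ∑ C ∈ comps G S, _ := Finset.card_biUnion_le
    _ ≤ ∑ C ∈ comps G S, ∑ v ∈ T ∩ C, reducedBound w S R v := by
      refine Finset.sum_le_sum fun C hC => ?_
      rw [mem_comps] at hC
      exact hS.card_filter_le hV hw hC Finset.inter_subset_right (hR C hC)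
    _ = ∑ v ∈ (comps G S).biUnion fun C => T ∩ C, reducedBound w S R v := by
      refine (Finset.sum_biUnion fun C hC D hD hne => ?_).symm
      exact (pairwiseDisjoint_comps G S hC hD hne).mono Finset.inter_subset_right
        Finset.inter_subset_right
    _ ≤ _ := Finset.sum_le_sum_of_subset
      (Finset.biUnion_subset.2 fun C _ => Finset.inter_subset_left)

/-- The odd components of `G - S` can be assigned to neighbours in an extreme barrier `S` so that
every `s ∈ S` receives `f s - 1` or `f s` of them. -/
lemma IsExtremeBarrier.exists_assignment {f : V → ℕ}
    (hS : IsExtremeBarrier G (fun v => f v - 1) S)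
    (hcond : ∀ T : Finset V, (oddComps G T).card ≤ ∑ v ∈ T, f v) :
    ∃ φ : oddComps G S → S, (∀ C, ∃ v ∈ C.1, G.Adj (φ C) v) ∧
      ∀ s : S, f s - 1 ≤ (Finset.univ.filter fun C => φ C = s).card ∧
        (Finset.univ.filter fun C => φ C = s).card ≤ f s := by
  have hle (X : Finset (oddComps G S)) (N : Finset V) (hN : N ⊆ S)
      (h : ∀ C ∈ X, ∀ a ∈ C.1, ∀ b ∈ S, G.Adj a b → b ∈ N) : X.card ≤ (oddComps G N).card := by
    refine Finset.card_le_card_of_injOn Subtype.val (fun C hC => ?_) Subtype.val_injective.injOn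
    have hCS := mem_oddComps.1 C.2
    refine mem_oddComps.2 ⟨hCS.1.congr (hCS.1.2.1.1.mono_right hN) fun a ha b hab => ?_, hCS.2⟩
    exact ⟨fun hb => h C hC a ha b hb hab, fun hb => hN hb⟩
  obtain ⟨A, hA⟩ : ∃ A : S → oddComps G S → Prop, ∀ s C, A s C ↔ ∃ v ∈ C.1, G.Adj s v :=
    ⟨_, fun _ _ => Iff.rfl⟩
  simp only [← hA]
  refine _root_.exists_assignment A (fun s => f s) (fun Y => ?_) fun X => ?_
  · let Y' : Finset V := Y.map (Function.Embedding.subtype _)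
    have hY' : Y' ⊆ S := Finset.map_subtype_subset Y
    have h1 := (hS (S \ Y')).1
    beta_reduce at h1
    rw [← Finset.sum_sdiff hY'] at h1
    have h2 := hle (Finset.univ.filter fun C => ¬ ∃ s ∈ Y, A s C) (S \ Y')
      Finset.sdiff_subset fun C hC a ha b hb hab => by
        rw [Finset.mem_filter_univ] at hC
        refine Finset.mem_sdiff.2 ⟨hb, fun hbY => hC ?_⟩
        obtain ⟨s, hs, rfl⟩ := Finset.mem_map.1 hbY
        exact ⟨s, hs, (hA s C).2 ⟨a, ha, hab.symm⟩⟩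
    have h3 := Finset.card_filter_add_card_filter_not (s := (Finset.univ : Finset (oddComps G S)))
      fun C => ∃ s ∈ Y, A s C
    rw [Finset.card_univ, Fintype.card_coe] at h3
    have h4 : ∑ v ∈ Y', (f v - 1) = ∑ s ∈ Y, (f s - 1) := Finset.sum_map _ _ _
    omega
  · let N : Finset S := Finset.univ.filter fun s => ∃ C ∈ X, A s C
    have h1 := hle X (N.map (Function.Embedding.subtype _)) (Finset.map_subtype_subset N)
      fun C hC a ha b hb hab => by
        refine Finset.mem_map.2 ⟨⟨b, hb⟩, (Finset.mem_filter_univ _).2 ⟨C, hC, ?_⟩, rfl⟩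
        exact (hA ⟨b, hb⟩ C).2 ⟨a, ha, hab.symm⟩
    have h2 := hcond (N.map (Function.Embedding.subtype _))
    rw [Finset.sum_map] at h2
    exact h1.trans h2

end Barrier

open scoped Classical in
lemma exists_factor_of_card_oddComps_le {V : Type*} [Fintype V] (G : SimpleGraph V)
    (f : V → ℕ) (hfe : ∀ v, Even (f v)) (hf : ∀ v, 0 < f v) (hV : Even (Fintype.card V))
    (hcond : ∀ T : Finset V, (oddComps G T).card ≤ ∑ v ∈ T, f v) :
    ∃ F ≤ G, ∀ v, (Odd (ndeg F v) ∧ ndeg F v ≤ f v - 1) ∨ ndeg F v = f v := by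
  have hw (v : V) : Odd (f v - 1) := Nat.Even.sub_odd (hf v) (hfe v) odd_one
  obtain ⟨S, hS⟩ := exists_isExtremeBarrier G fun v => f v - 1
  obtain ⟨φ, hφ, hcard⟩ := hS.exists_assignment hcond
  choose x hxC hφx using hφ
  have hcomp (C : oddComps G S) : IsComp G S C.1 := (mem_oddComps.1 C.2).1
  have hxS (C : oddComps G S) : x C ∉ S := (hcomp C).notMem (hxC C)
  have hx : Function.Injective x := fun C D h =>
    Subtype.ext ((hcomp C).eq_of_mem (hcomp D) (hxC C) (h ▸ hxC D))
  let R : Finset V := Finset.univ.image x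
  have hR (C : Finset V) (hC : IsComp G S C) : (C ∩ R).card = if Odd C.card then 1 else 0 := by
    have hmem (D : oddComps G S) (hD : x D ∈ C) : D.1 = C := (hcomp D).eq_of_mem hC (hxC D) hD
    split_ifs with hodd
    · let D : oddComps G S := ⟨C, mem_oddComps.2 ⟨hC, hodd⟩⟩
      rw [Finset.card_eq_one]
      refine ⟨x D, Finset.Subset.antisymm (fun v hv => ?_) ?_⟩
      · obtain ⟨hvC, hvR⟩ := Finset.mem_inter.1 hv
        obtain ⟨E, -, rfl⟩ := Finset.mem_image.1 hvR
        rw [Finset.mem_singleton, show E = D from Subtype.ext (hmem E hvC)]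
      · rw [Finset.singleton_subset_iff]
        exact Finset.mem_inter.2 ⟨hxC D, Finset.mem_image_of_mem _ (Finset.mem_univ _)⟩
    · rw [Finset.card_eq_zero, Finset.eq_empty_iff_forall_notMem]
      intro v hv
      obtain ⟨hvC, hvR⟩ := Finset.mem_inter.1 hv
      obtain ⟨E, -, rfl⟩ := Finset.mem_image.1 hvR
      exact hodd (hmem E hvC ▸ (mem_oddComps.1 E.2).2)
  obtain ⟨F, hFG, hF⟩ := hS.exists_parity_factor hV hw hR
  have hFS (v u : V) (hv : v ∈ S) : ¬ F.Adj v u := fun h => by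
    have h1 := (hF v).1
    rw [reducedBound, if_pos hv, ndeg_eq_card, Nat.le_zero, Finset.card_eq_zero,
      Finset.filter_eq_empty_iff] at h1
    exact h1 (Finset.mem_univ u) h
  obtain ⟨H, hH⟩ : ∃ H : SimpleGraph V, ∀ a b, H.Adj a b ↔ F.Adj a b ∨
      ∃ C, (φ C : V) = a ∧ x C = b ∨ (φ C : V) = b ∧ x C = a := by
    refine ⟨⟨_, ⟨fun a b h => ?_⟩, ⟨fun a h => ?_⟩⟩, fun _ _ => Iff.rfl⟩
    · exact h.imp SimpleGraph.Adj.symm fun ⟨C, hC⟩ => ⟨C, hC.symm⟩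
    · rcases h with h | ⟨C, h | h⟩
      · exact F.loopless.irrefl a h
      all_goals exact hxS C (h.2 ▸ h.1 ▸ (φ C).2)
  refine ⟨H, fun a b hab => ?_, fun v => ?_⟩
  · rw [hH] at hab
    rcases hab with h | ⟨C, ⟨rfl, rfl⟩ | ⟨rfl, rfl⟩⟩
    · exact hFG h
    · exact hφx C
    · exact (hφx C).symm
  by_cases hv : v ∈ S
  · have hdeg : ndeg H v = (Finset.univ.filter fun C => φ C = ⟨v, hv⟩).card := by
      rw [ndeg_eq_card, ← Finset.card_image_of_injective _ hx]
      congr 1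
      ext u
      rw [Finset.mem_filter_univ, hH, or_iff_right (hFS v u hv), Finset.mem_image]
      refine exists_congr fun C => ?_
      rw [Finset.mem_filter_univ, Subtype.ext_iff, or_iff_left]
      exact fun h => hxS C (h.2 ▸ hv)
    have h := hcard ⟨v, hv⟩
    rw [← hdeg] at h
    rcases h.2.eq_or_lt with heq | hlt
    · exact Or.inr heq
    · have heq : ndeg H v = f v - 1 := le_antisymm (Nat.le_sub_one_of_lt hlt) h.1
      exact Or.inl ⟨heq ▸ hw v, heq.le⟩
  · have hdeg : ndeg H v = ndeg F v + if v ∈ R then 1 else 0 := by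
      rw [ndeg_eq_card, ndeg_eq_card]
      split_ifs with hvR
      · obtain ⟨C, -, rfl⟩ := Finset.mem_image.1 hvR
        have hC : (φ C : V) ∉ Finset.univ.filter fun u => F.Adj (x C) u := fun h =>
          hFS _ _ (φ C).2 ((Finset.mem_filter_univ _).1 h).symm
        rw [← Finset.card_insert_of_notMem hC]
        congr 1
        ext u
        rw [Finset.mem_filter_univ, hH, Finset.mem_insert, Finset.mem_filter_univ, or_comm]
        refine or_congr_left ⟨?_, fun h => ⟨C, Or.inr ⟨h.symm, rfl⟩⟩⟩
        rintro ⟨D, h | h⟩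
        · exact absurd (h.1 ▸ (φ D).2) hv
        · rw [← h.1, hx h.2]
      · rw [add_zero]
        congr 1
        ext u
        rw [Finset.mem_filter_univ, hH, Finset.mem_filter_univ, or_iff_left]
        rintro ⟨D, h | h⟩
        · exact hv (h.1 ▸ (φ D).2)
        · exact hvR (h.2 ▸ Finset.mem_image_of_mem _ (Finset.mem_univ _))
    have h := hF v
    have h1 := hw v
    rw [reducedBound, if_neg hv] at h
    left
    rw [hdeg]
    rw [Nat.odd_iff] at h1 ⊢
    rw [Nat.odd_iff, Nat.odd_iff] at h
    split_ifs at h ⊢ <;> omega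

/-- Even order: if `o(G-S) ≤ f(S)` for all `S`, then `G` has an `H_f`-factor. -/
theorem stmt_2 {V : Type*} [Fintype V] (G : SimpleGraph V)
    (f : V → ℕ) (hfe : ∀ v, Even (f v)) (hf4 : ∀ v, 4 ≤ f v)
    (heven : Even (Fintype.card V))
    (hcond : ∀ S : Finset V, oddComp G (↑S : Set V) ≤ ∑ v ∈ S, f v) :
    ∃ F : SimpleGraph V, F ≤ G ∧
      ∀ v : V, (Odd (ndeg F v) ∧ ndeg F v ≤ f v - 1) ∨ ndeg F v = f v := by
  refine exists_factor_of_card_oddComps_le G f hfe (fun v => ?_) heven fun T => ?_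
  · exact four_pos.trans_le (hf4 v)
  · rw [card_oddComps_eq_oddComp]
    exact hcond T
end

section
/- Let G be a connected finite simple graph of odd order and f : V(G) → ℕ even-valued with f(v) ≥ 4, such that d_G(v) ≥ f(v) − 1 for all v. If o(G − S) ≤ Σ_{v∈S} f(v) for every nonempty S ⊆ V(G), then G has a spanning subgraph F with d_F(v) ∈ {1,3,...,f(v)−1, f(v)} for every vertex v. -/
open SimpleGraph

namespace OddFactor

set_option linter.unusedSectionVars false

open Finset

variable {V : Type*} [Fintype V] {G : SimpleGraph V} {X Y K L C : Finset V} {a b v : V}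

/-- `K` is a union of vertex sets of components of `G - X`, up to vertices of `X`. -/
def IsClosedOff (G : SimpleGraph V) (X K : Finset V) : Prop :=
  ∀ a ∈ K, ∀ b, b ∉ X → G.Adj a b → b ∈ K

/-- `K` is the vertex set of a connected component of `G - X`. -/
structure IsComp (G : SimpleGraph V) (X K : Finset V) : Prop where
  nonempty : K.Nonempty
  disjoint : ∀ a ∈ K, a ∉ X
  closed : IsClosedOff G X K
  minimal : ∀ L ⊆ K, L.Nonempty → IsClosedOff G X L → L = K

open Classical in
/-- The vertex sets of the connected components of `G - X`. -/
noncomputable def comps (G : SimpleGraph V) (X : Finset V) : Finset (Finset V) :=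
  {K | IsComp G X K}

open Classical in
/-- The vertex sets of the odd connected components of `G - X`. -/
noncomputable def oddComps (G : SimpleGraph V) (X : Finset V) : Finset (Finset V) :=
  {K ∈ comps G X | Odd #K}

@[simp] lemma mem_comps : K ∈ comps G X ↔ IsComp G X K := by simp [comps]

@[simp] lemma mem_oddComps : K ∈ oddComps G X ↔ IsComp G X K ∧ Odd #K := by simp [oddComps]

lemma IsComp.subset_of_isClosedOff (hK : IsComp G X K) (hC : IsClosedOff G X C)
    (ha : a ∈ K) (haC : a ∈ C) : K ⊆ C := by
  classical
  have := hK.minimal (K ∩ C) inter_subset_left ⟨a, by simp [ha, haC]⟩ (by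
    intro x hx b hb hxb
    rw [mem_inter] at hx ⊢
    exact ⟨hK.closed x hx.1 b hb hxb, hC x hx.2 b hb hxb⟩)
  exact inter_eq_left.1 this

lemma IsComp.eq_of_mem (hK : IsComp G X K) (hL : IsComp G X L) (ha : a ∈ K) (haL : a ∈ L) :
    K = L :=
  (hK.subset_of_isClosedOff hL.closed ha haL).antisymm
    (hL.subset_of_isClosedOff hK.closed haL ha)

lemma exists_isComp_mem (hv : v ∉ X) : ∃ K, IsComp G X K ∧ v ∈ K := by
  classical
  let P : Finset (Finset V) := {K | v ∈ K ∧ (∀ a ∈ K, a ∉ X) ∧ IsClosedOff G X K}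
  have hP : P.Nonempty := ⟨Xᶜ, by
    simp only [P, mem_filter, mem_univ, true_and, mem_compl]
    exact ⟨hv, fun _ h => h, fun a _ b hb _ => by simpa using hb⟩⟩
  obtain ⟨K, hKP, hmin⟩ := exists_min_image P card hP
  simp only [P, mem_filter, mem_univ, true_and] at hKP hmin
  refine ⟨K, ⟨⟨v, hKP.1⟩, hKP.2.1, hKP.2.2, ?_⟩, hKP.1⟩
  intro L hLK hL hLc
  by_cases hvL : v ∈ L
  · exact eq_of_subset_of_card_le hLK
      (hmin L ⟨hvL, fun a ha => hKP.2.1 a (hLK ha), hLc⟩)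
  · have h := hmin (K \ L) ⟨by simp [hvL, hKP.1], fun a ha => hKP.2.1 a (sdiff_subset ha), by
      intro a ha b hb hab
      rw [mem_sdiff] at ha ⊢
      refine ⟨hKP.2.2 a ha.1 b hb hab, fun hbL => ha.2 ?_⟩
      exact hLc b hbL a (hKP.2.1 a ha.1) hab.symm⟩
    have h1 := card_sdiff_add_card_eq_card hLK
    have h2 := hL.card_pos
    omega

/-- The vertex sets of the odd components, counted through a model `H` of `G - X`. -/
lemma card_odd_components (X : Finset V) (s : Set V) (H : SimpleGraph s)
    (hH : ∀ a b, H.Adj a b ↔ G.Adj a b) (hs : ∀ v, v ∈ s ↔ v ∉ X) :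
    Nat.card {c : H.ConnectedComponent // Odd (Nat.card c.supp)} = #(oddComps G X) := by
  classical
  let φ : H.ConnectedComponent → Finset V := fun c => {v | ∃ h : v ∈ s, H.connectedComponentMk ⟨v, h⟩ = c}
  have mem_φ : ∀ c v, v ∈ φ c ↔ ∃ h : v ∈ s, H.connectedComponentMk ⟨v, h⟩ = c := by simp [φ]
  have cardφ : ∀ c, Nat.card c.supp = #(φ c) := by
    intro c
    rw [← Nat.card_eq_finsetCard]
    refine Nat.card_congr ⟨fun x => ⟨x.1.1, (mem_φ _ _).2 ⟨x.1.2, x.2⟩⟩,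
      fun y => ⟨⟨y.1, ((mem_φ _ _).1 y.2).1⟩, ((mem_φ _ _).1 y.2).2⟩, fun x => rfl, fun y => rfl⟩
  have reach : ∀ L : Finset V, IsClosedOff G X L → ∀ x y : s, H.Reachable x y →
      x.1 ∈ L → y.1 ∈ L := by
    rintro L hL x y ⟨p⟩
    induction p with
    | nil => exact id
    | @cons u v w h p ih =>
      exact fun hu => ih (hL _ hu _ ((hs _).1 v.2) ((hH _ _).1 h))
  have compφ : ∀ c, IsComp G X (φ c) := by
    intro c
    obtain ⟨x, rfl⟩ := c.exists_rep
    refine ⟨⟨x.1, (mem_φ _ _).2 ⟨x.2, rfl⟩⟩, ?_, ?_, ?_⟩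
    · intro a ha
      exact (hs _).1 ((mem_φ _ _).1 ha).1
    · intro a ha b hb hab
      obtain ⟨has, hac⟩ := (mem_φ _ _).1 ha
      refine (mem_φ _ _).2 ⟨(hs _).2 hb, ?_⟩
      rw [← hac]
      exact ConnectedComponent.sound ((hH ⟨b, (hs _).2 hb⟩ ⟨a, has⟩).2 hab.symm).reachable
    · rintro L hL ⟨l, hl⟩ hLc
      refine hL.antisymm fun y hy => ?_
      obtain ⟨hys, hyc⟩ := (mem_φ _ _).1 hy
      obtain ⟨hls, hlc⟩ := (mem_φ _ _).1 (hL hl)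
      exact reach L hLc ⟨l, hls⟩ ⟨y, hys⟩ (ConnectedComponent.exact (hlc.trans hyc.symm)) hl
  rw [← Nat.card_eq_finsetCard]
  refine Nat.card_congr (Equiv.ofBijective
    (fun c => ⟨φ c.1, mem_oddComps.2 ⟨compφ _, cardφ c.1 ▸ c.2⟩⟩) ⟨?_, ?_⟩)
  · rintro ⟨c, hc⟩ ⟨d, hd⟩ h
    simp only [Subtype.mk.injEq] at h ⊢
    obtain ⟨x, rfl⟩ := c.exists_rep
    have : x.1 ∈ φ d := h ▸ (mem_φ _ _).2 ⟨x.2, rfl⟩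
    exact ((mem_φ _ _).1 this).2
  · rintro ⟨K, hK⟩
    obtain ⟨hK, hodd⟩ := mem_oddComps.1 hK
    obtain ⟨v, hv⟩ := hK.nonempty
    have hvs : v ∈ s := (hs v).2 (hK.disjoint v hv)
    have : φ (H.connectedComponentMk ⟨v, hvs⟩) = K :=
      (compφ _).eq_of_mem hK ((mem_φ _ _).2 ⟨hvs, rfl⟩) hv
    exact ⟨⟨H.connectedComponentMk ⟨v, hvs⟩, by rwa [cardφ, this]⟩, Subtype.ext this⟩

lemma oddComp_eq_card (G : SimpleGraph V) (X : Finset V) :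
    oddComp G (X : Set V) = #(oddComps G X) :=
  card_odd_components X _ _ (by simp) (by simp)

/-- Tutte's theorem, with the odd components given by their vertex sets. -/
lemma exists_isPerfectMatching (h : ∀ T : Finset V, #(oddComps G T) ≤ #T) :
    ∃ M : G.Subgraph, M.IsPerfectMatching := by
  classical
  refine tutte.2 fun u hu => ?_
  have h1 := h u.toFinset
  rw [← card_odd_components u.toFinset ((⊤ : G.Subgraph).deleteVerts u).verts
    ((⊤ : G.Subgraph).deleteVerts u).coe (by
      rintro ⟨a, ha⟩ ⟨b, hb⟩
      simp at ha hb
      simp [ha, hb]) (by simp)] at h1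
  rw [IsTutteViolator, Set.ncard_eq_toFinset_card' u] at hu
  exact absurd h1 (not_le.2 hu)

/-- The graph obtained from `G` by replacing each `v` by a clique of size `h v`. -/
def blowUp (G : SimpleGraph V) (h : V → ℕ) : SimpleGraph (Σ v, Fin (h v)) where
  Adj x y := G.Adj x.1 y.1 ∨ x.1 = y.1 ∧ x ≠ y
  symm := ⟨fun _ _ h => h.imp (fun h => h.symm) (fun h => ⟨h.1.symm, h.2.symm⟩)⟩
  loopless := ⟨fun _ h => h.elim G.irrefl (fun h => h.2 rfl)⟩

lemma blowUp_adj {h : V → ℕ} {x y : Σ v, Fin (h v)} :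
    (blowUp G h).Adj x y ↔ G.Adj x.1 y.1 ∨ x.1 = y.1 ∧ x ≠ y := Iff.rfl

section BlowUp

variable {h : V → ℕ} {T K' : Finset (Σ v, Fin (h v))}

open Classical in
/-- The vertices all of whose copies lie in `T`. -/
noncomputable def fullFibres (T : Finset (Σ v, Fin (h v))) : Finset V := {v | ∀ i, ⟨v, i⟩ ∈ T}

lemma mem_fullFibres : v ∈ fullFibres T ↔ ∀ i, (⟨v, i⟩ : Σ v, Fin (h v)) ∈ T := by
  simp [fullFibres]

lemma IsComp.mem_of_fst_eq (hK : IsComp (blowUp G h) T K') {x y : Σ v, Fin (h v)} (hx : x ∈ K')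
    (hy : y ∉ T) (hxy : x.1 = y.1) : y ∈ K' := by
  by_cases h : x = y
  · exact h ▸ hx
  · exact hK.closed x hx y hy (Or.inr ⟨hxy, h⟩)

open Classical in
lemma IsComp.image_fst (hK : IsComp (blowUp G h) T K') :
    IsComp G (fullFibres T) (K'.image Sigma.fst) := by
  refine ⟨hK.nonempty.image _, ?_, ?_, ?_⟩
  · intro a ha haT
    obtain ⟨x, hx, rfl⟩ := mem_image.1 ha
    exact hK.disjoint x hx (mem_fullFibres.1 haT x.2)
  · intro a ha b hb hab
    obtain ⟨x, hx, rfl⟩ := mem_image.1 ha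
    rw [mem_fullFibres] at hb
    push Not at hb
    obtain ⟨i, hi⟩ := hb
    exact mem_image.2 ⟨⟨b, i⟩, hK.closed x hx _ hi (Or.inl hab), rfl⟩
  · rintro L hL ⟨l, hl⟩ hLc
    have h1 : K'.filter (fun x => x.1 ∈ L) = K' := by
      refine hK.minimal _ (filter_subset _ _) ?_ ?_
      · obtain ⟨x, hx, rfl⟩ := mem_image.1 (hL hl)
        exact ⟨x, mem_filter.2 ⟨hx, hl⟩⟩
      · intro x hx y hy hxy
        rw [mem_filter] at hx ⊢
        refine ⟨hK.closed x hx.1 y hy hxy, ?_⟩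
        rcases blowUp_adj.1 hxy with hxy | hxy
        · exact hLc _ hx.2 _ (fun hT => hy (mem_fullFibres.1 hT y.2)) hxy
        · exact hxy.1 ▸ hx.2
    refine hL.antisymm fun v hv => ?_
    obtain ⟨x, hx, rfl⟩ := mem_image.1 hv
    rw [← h1] at hx
    exact (mem_filter.1 hx).2

open Classical in
lemma IsComp.eq_filter (hK : IsComp (blowUp G h) T K') :
    K' = univ.filter (fun x => x.1 ∈ K'.image Sigma.fst ∧ x ∉ T) := by
  ext x
  simp only [mem_filter, mem_univ, true_and]
  refine ⟨fun hx => ⟨mem_image_of_mem _ hx, hK.disjoint x hx⟩, fun ⟨hx, hxT⟩ => ?_⟩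
  obtain ⟨y, hy, hyx⟩ := mem_image.1 hx
  exact hK.mem_of_fst_eq hy hxT hyx

open Classical in
lemma IsComp.card_add (hK : IsComp (blowUp G h) T K') :
    #K' + #(T.filter (fun x => x.1 ∈ K'.image Sigma.fst)) = ∑ v ∈ K'.image Sigma.fst, h v := by
  have h1 : ∑ v ∈ K'.image Sigma.fst, h v =
      #((K'.image Sigma.fst).sigma (fun v => (univ : Finset (Fin (h v))))) := by
    simp [card_sigma]
  rw [h1, ← card_filter_add_card_filter_not (s := (K'.image Sigma.fst).sigma _) (fun x => x ∉ T)]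
  refine congrArg₂ _ (congrArg card ?_) (congrArg card ?_)
  · conv_lhs => rw [hK.eq_filter]
    ext x
    simp
  · ext x
    simp [and_comm]

open Classical in
lemma card_oddComps_blowUp_le (G : SimpleGraph V) (T : Finset (Σ v, Fin (h v)))
    (hX : #((comps G (fullFibres T)).filter (fun K => Odd (∑ v ∈ K, h v))) ≤
      ∑ v ∈ fullFibres T, h v) :
    #(oddComps (blowUp G h) T) ≤ #T := by
  have inj : ∀ K ∈ oddComps (blowUp G h) T, ∀ L ∈ oddComps (blowUp G h) T, ∀ v,
      v ∈ K.image Sigma.fst → v ∈ L.image Sigma.fst → K = L := by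
    intro K hK L hL v hvK hvL
    rw [mem_oddComps] at hK hL
    obtain ⟨x, hx, rfl⟩ := mem_image.1 hvK
    obtain ⟨y, hy, hxy⟩ := mem_image.1 hvL
    exact hK.1.eq_of_mem hL.1 hx (hL.1.mem_of_fst_eq hy (hK.1.disjoint x hx) hxy)
  rw [← card_filter_add_card_filter_not (s := oddComps (blowUp G h) T)
      (fun K => Odd (∑ v ∈ K.image Sigma.fst, h v)),
    ← card_filter_add_card_filter_not (s := T) (fun x => x.1 ∈ fullFibres T)]
  refine add_le_add (le_trans ?_ (hX.trans (le_of_eq ?_))) ?_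
  · refine card_le_card_of_injOn (fun K => K.image Sigma.fst) ?_ ?_
    · intro K hK
      obtain ⟨hK, hodd⟩ := mem_filter.1 hK
      exact mem_filter.2 ⟨mem_comps.2 (mem_oddComps.1 hK).1.image_fst, hodd⟩
    · intro K hK L hL hKL
      have hK := (mem_filter.1 hK).1
      have hL := (mem_filter.1 hL).1
      obtain ⟨x, hx⟩ := (mem_oddComps.1 hK).1.nonempty
      have h1 : x.1 ∈ K.image Sigma.fst := mem_image_of_mem _ hx
      exact inj K hK L hL x.1 h1 (by simpa only [← show _ = _ from hKL] using h1)
  · have h1 : ∑ v ∈ fullFibres T, h v =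
      #((fullFibres T).sigma (fun v => (univ : Finset (Fin (h v))))) := by simp [card_sigma]
    rw [h1]
    congr 1
    ext x
    simp only [mem_sigma, mem_univ, and_true, mem_filter]
    exact ⟨fun hx => ⟨mem_fullFibres.1 hx x.2, hx⟩, fun hx => hx.2⟩
  · have key : ∀ K ∈ (oddComps (blowUp G h) T).filter
        (fun K => ¬ Odd (∑ v ∈ K.image Sigma.fst, h v)),
        ∃ x ∈ T.filter (fun x => x.1 ∉ fullFibres T), x.1 ∈ K.image Sigma.fst := by
      intro K hK
      obtain ⟨hK, hodd⟩ := mem_filter.1 hK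
      obtain ⟨hK, hKodd⟩ := mem_oddComps.1 hK
      rw [← hK.card_add] at hodd
      have h1 : (T.filter (fun x => x.1 ∈ K.image Sigma.fst)).Nonempty := by
        rw [nonempty_iff_ne_empty]
        intro h0
        rw [h0] at hodd
        exact hodd (by simpa using hKodd)
      obtain ⟨x, hx⟩ := h1
      rw [mem_filter] at hx
      exact ⟨x, mem_filter.2 ⟨hx.1, hK.image_fst.disjoint _ hx.2⟩, hx.2⟩
    refine card_le_card_of_forall_subsingleton (fun K x => x.1 ∈ K.image Sigma.fst) key ?_
    rintro x - K ⟨hK, hxK⟩ L ⟨hL, hxL⟩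
    exact inj K (mem_filter.1 hK).1 L (mem_filter.1 hL).1 _ hxK hxL

open Classical in
/-- If `o_h(G - X) ≤ h(X)` for all `X`, then `G` has a spanning subgraph whose degrees are at
most `h` and have the parity of `h`. -/
lemma exists_parity_factor (G : SimpleGraph V) (h : V → ℕ)
    (hX : ∀ X, (∀ v, h v = 0 → v ∈ X) →
      #((comps G X).filter (fun K => Odd (∑ v ∈ K, h v))) ≤ ∑ v ∈ X, h v) :
    ∃ F ≤ G, ∀ v, ndeg F v ≤ h v ∧ (Odd (ndeg F v) ↔ Odd (h v)) := by
  obtain ⟨M, hM⟩ := exists_isPerfectMatching (G := blowUp G h) fun T =>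
    card_oddComps_blowUp_le G T (hX _ (by
      intro v hv
      rw [mem_fullFibres]
      intro i
      exact absurd i.2 (by omega)))
  rw [Subgraph.isPerfectMatching_iff] at hM
  choose μ hμ hμ' using hM
  have hinv : ∀ x, μ (μ x) = x := fun x => (hμ' (μ x) x (hμ x).symm).symm
  have hne : ∀ x, μ x ≠ x := fun x hx => (hμ x).ne hx.symm
  let n : V → V → ℕ := fun v u => #{x : Σ v, Fin (h v) | x.1 = v ∧ (μ x).1 = u}
  have hsymm : ∀ v u, n v u = n u v := by
    intro v u
    refine card_bij' (fun x _ => μ x) (fun x _ => μ x) ?_ ?_ ?_ ?_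
    · intro x; simp only [mem_filter, mem_univ, true_and, hinv]; tauto
    · intro x; simp only [mem_filter, mem_univ, true_and, hinv]; tauto
    · simp [hinv]
    · simp [hinv]
  have hself : ∀ v, Even (n v v) := by
    intro v
    simp only [n]
    rw [← ZMod.natCast_eq_zero_iff_even, card_eq_sum_ones, Nat.cast_sum]
    refine sum_involution (fun x _ => μ x) ?_ ?_ ?_ ?_
    · intros; decide
    · intros; exact hne _
    · intro x hx
      simp only [mem_filter, mem_univ, true_and, hinv] at hx ⊢
      tauto
    · intros; exact hinv _
  have hsum : ∀ v, ∑ u, n v u = h v := by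
    intro v
    have h1 : #(({v} : Finset V).sigma (fun v => (univ : Finset (Fin (h v))))) = h v := by simp
    rw [← h1, card_eq_sum_card_fiberwise (f := fun x => (μ x).1) (t := univ) (by simp)]
    refine sum_congr rfl fun u _ => congrArg card ?_
    ext x
    simp
  let F : SimpleGraph V :=
    { Adj := fun v u => v ≠ u ∧ Odd (n v u)
      symm := ⟨fun v u h => ⟨h.1.symm, hsymm v u ▸ h.2⟩⟩
      loopless := ⟨fun _ h => h.1 rfl⟩ }
  have hdeg : ∀ v, ndeg F v = #((univ.erase v).filter (fun u => Odd (n v u))) := by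
    intro v
    rw [ndeg, ← Nat.card_eq_finsetCard]
    refine Nat.card_congr (Equiv.subtypeEquivRight fun u => ?_)
    simp [F, eq_comm]
  refine ⟨F, ?_, fun v => ⟨?_, ?_⟩⟩
  · rintro v u ⟨hvu, hodd⟩
    obtain ⟨x, hx⟩ := card_pos.1 hodd.pos
    simp only [mem_filter, mem_univ, true_and] at hx
    obtain ⟨rfl, rfl⟩ := hx
    rcases blowUp_adj.1 (hμ x).adj_sub with hadj | hadj
    · exact hadj
    · exact absurd hadj.1 hvu
  · rw [hdeg, ← hsum v, card_eq_sum_ones]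
    refine (sum_le_sum fun u hu => (mem_filter.1 hu).2.pos).trans
      (sum_le_sum_of_subset (subset_univ _))
  · rw [hdeg, ← odd_sum_iff_odd_card_odd, ← hsum v, ← add_sum_erase _ _ (mem_univ v),
      Nat.odd_add']
    simp [hself v]

end BlowUp

section Barrier

variable {S Z e : Finset V} {g h : V → ℕ}

lemma isClosedOff_of_inter_eq [DecidableEq V] (hC : IsClosedOff G S C) (hSZ : S ⊆ Z)
    (hXZ : X ∩ C = Z ∩ C) (hKC : K ⊆ C) (hK : IsClosedOff G X K) : IsClosedOff G Z K := by
  intro a ha b hb hab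
  have hbC : b ∈ C := hC a (hKC ha) b (fun h => hb (hSZ h)) hab
  refine hK a ha b (fun hbX => hb ?_) hab
  exact (mem_inter.1 (hXZ ▸ mem_inter.2 ⟨hbX, hbC⟩ : b ∈ Z ∩ C)).1

lemma IsComp.congr_of_inter_eq [DecidableEq V] (hC : IsClosedOff G S C) (hSX : S ⊆ X)
    (hSZ : S ⊆ Z) (hXZ : X ∩ C = Z ∩ C) (hKC : K ⊆ C) (hK : IsComp G X K) : IsComp G Z K := by
  refine ⟨hK.nonempty, fun a ha haZ => ?_,
    isClosedOff_of_inter_eq hC hSZ hXZ hKC hK.closed, fun L hL hLn hLc => ?_⟩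
  · exact hK.disjoint a ha
      (mem_inter.1 (hXZ ▸ mem_inter.2 ⟨haZ, hKC ha⟩ : a ∈ X ∩ C)).1
  · exact hK.minimal L hL hLn
      (isClosedOff_of_inter_eq hC hSX hXZ.symm (hL.trans hKC) hLc)

lemma odd_sum_iff_odd_card (hg : ∀ v, Odd (g v)) (K : Finset V) :
    Odd (∑ v ∈ K, g v) ↔ Odd #K := by
  rw [odd_sum_iff_odd_card_odd, filter_true_of_mem fun v _ => hg v]

open Classical in
lemma sum_add_card_inter (hh : ∀ v ∉ S, h v + (if v ∈ e then 1 else 0) = g v)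
    (hK : ∀ a ∈ K, a ∉ S) : ∑ v ∈ K, h v + #(K ∩ e) = ∑ v ∈ K, g v := by
  rw [← filter_mem_eq_inter, card_filter, ← sum_add_distrib]
  exact sum_congr rfl fun v hv => hh v (hK v hv)

open Classical in
lemma odd_card_sdiff_iff (hC : IsClosedOff G S C) (hSX : S ⊆ X) :
    Odd #(C \ X) ↔ Odd #{K ∈ oddComps G X | K ⊆ C} := by
  have h1 : C \ X = ((comps G X).filter (· ⊆ C)).biUnion id := by
    ext v
    simp only [mem_sdiff, mem_biUnion, mem_filter, mem_comps, id]
    constructor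
    · rintro ⟨hvC, hvX⟩
      obtain ⟨K, hK, hvK⟩ := exists_isComp_mem (G := G) hvX
      refine ⟨K, ⟨hK, hK.subset_of_isClosedOff (fun a ha b hb => ?_) hvK hvC⟩, hvK⟩
      exact hC a ha b fun h => hb (hSX h)
    · rintro ⟨K, ⟨hK, hKC⟩, hv⟩
      exact ⟨hKC hv, hK.disjoint v hv⟩
  rw [h1, card_biUnion, odd_sum_iff_odd_card_odd]
  · refine iff_of_eq (congrArg (fun s : Finset (Finset V) => Odd #s) ?_)
    ext K
    simp only [mem_filter, mem_comps, mem_oddComps, id]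
    tauto
  · intro K hK L hL hKL
    simp only [mem_coe, mem_filter, mem_comps] at hK hL
    change Disjoint K L
    rw [Finset.disjoint_left]
    exact fun a haK haL => hKL (hK.1.eq_of_mem hL.1 haK haL)

open Classical in
lemma card_filter_comps_subset_le (hg : ∀ v, Odd (g v))
    (hmax : ∀ Y, S ⊂ Y → #(oddComps G Y) + ∑ v ∈ S, g v < #(oddComps G S) + ∑ v ∈ Y, g v)
    (he : ∀ C, IsComp G S C → #(C ∩ e) = if Odd #C then 1 else 0)
    (hh : ∀ v ∉ S, h v + (if v ∈ e then 1 else 0) = g v)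
    (hSX : S ⊆ X) (hC : IsComp G S C) :
    #{K ∈ comps G X | K ⊆ C ∧ Odd (∑ v ∈ K, h v)} ≤ ∑ v ∈ X ∩ C, h v := by
  have hCe := he C hC
  rcases (X ∩ C).eq_empty_or_nonempty with hY | hY
  · rw [hY, sum_empty, Nat.le_zero, card_eq_zero, filter_eq_empty_iff]
    rintro K hK ⟨hKC, hodd⟩
    have hK' : IsComp G S K := IsComp.congr_of_inter_eq hC.closed hSX subset_rfl (by
      rw [hY, eq_comm, eq_empty_iff_forall_notMem]
      intro a ha
      exact hC.disjoint a (mem_inter.1 ha).2 (mem_inter.1 ha).1) hKC (mem_comps.1 hK)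
    obtain rfl := hC.minimal K hKC hK'.nonempty hK'.closed
    have h1 := sum_add_card_inter hh hC.disjoint
    have h2 := odd_sum_iff_odd_card hg K
    rw [← h1, hCe, Nat.odd_add] at h2
    by_cases h3 : Odd #K <;> simp [h3, hodd] at h2
  · set Y := X ∩ C with hYdef
    have hYS : ∀ a ∈ Y, a ∉ S := fun a ha => hC.disjoint a (mem_inter.1 ha).2
    have hXZ : X ∩ C = (S ∪ Y) ∩ C := by
      ext a
      have := hC.disjoint a
      simp only [hYdef, mem_inter, mem_union]
      tauto
    set P := (oddComps G (S ∪ Y)).filter (· ⊆ C) with hP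
    have h_odd : #{K ∈ comps G X | K ⊆ C ∧ Odd (∑ v ∈ K, h v)} ≤ #P + #((C ∩ e) \ X) := by
      rw [← card_filter_add_card_filter_not (fun K => Odd #K)]
      refine add_le_add (card_le_card fun K hK => ?_) ?_
      · simp only [mem_filter, mem_comps] at hK
        refine mem_filter.2 ⟨mem_oddComps.2 ⟨?_, hK.2⟩, hK.1.2.1⟩
        exact hK.1.1.congr_of_inter_eq hC.closed hSX subset_union_left hXZ hK.1.2.1
      · refine card_le_card_of_forall_subsingleton (fun K v => v ∈ K) ?_ ?_
        · intro K hK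
          simp only [mem_filter, mem_comps] at hK
          have h1 := sum_add_card_inter hh fun a ha => hC.disjoint a (hK.1.2.1 ha)
          have h2 := odd_sum_iff_odd_card hg K
          rw [← h1, Nat.odd_add] at h2
          have h3 : (K ∩ e).Nonempty := by
            rw [← card_pos, Nat.pos_iff_ne_zero]
            intro h0
            rw [h0] at h2
            have h4 : Odd (∑ v ∈ K, h v) := hK.1.2.2
            exact hK.2 (h2.1 (by simp [h4]))
          obtain ⟨v, hv⟩ := h3
          rw [mem_inter] at hv
          refine ⟨v, ?_, hv.1⟩
          rw [mem_sdiff, mem_inter]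
          exact ⟨⟨hK.1.2.1 hv.1, hv.2⟩, hK.1.1.disjoint v hv.1⟩
        · rintro v - K ⟨hK, hvK⟩ L ⟨hL, hvL⟩
          simp only [mem_filter, mem_comps] at hK hL
          exact hK.1.1.eq_of_mem hL.1.1 hvK hvL
    have h_rest : #(oddComps G S) ≤
        #((oddComps G (S ∪ Y)).filter (fun K => ¬ K ⊆ C)) + if Odd #C then 1 else 0 := by
      rw [← card_filter_add_card_filter_not (s := oddComps G S) (fun K => K ≠ C)]
      refine add_le_add (card_le_card fun K hK => ?_) ?_
      · obtain ⟨hK, hKC⟩ := mem_filter.1 hK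
        obtain ⟨hK, hodd⟩ := mem_oddComps.1 hK
        refine mem_filter.2 ⟨mem_oddComps.2 ⟨?_, hodd⟩, fun hsub => ?_⟩
        · refine hK.congr_of_inter_eq hK.closed subset_rfl subset_union_left ?_ subset_rfl
          ext a
          simp only [mem_inter, mem_union, hYdef]
          refine ⟨fun h => ⟨Or.inl h.1, h.2⟩, ?_⟩
          rintro ⟨h | h, haK⟩
          · exact ⟨h, haK⟩
          · exact absurd (hK.eq_of_mem hC haK h.2) hKC
        · obtain ⟨a, ha⟩ := hK.nonempty
          exact hKC (hK.eq_of_mem hC ha (hsub ha))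
      · split_ifs with hodd
        · refine (card_le_card fun K hK => ?_).trans (card_singleton C).le
          simpa using (mem_filter.1 hK).2
        · rw [Nat.le_zero, card_eq_zero, filter_eq_empty_iff]
          rintro K hK h
          rw [not_not] at h
          exact hodd (h ▸ (mem_oddComps.1 hK).2)
    have h_strict := hmax (S ∪ Y) (by
      obtain ⟨a, ha⟩ := hY
      exact ssubset_iff_of_subset subset_union_left |>.2 ⟨a, mem_union_right _ ha, hYS a ha⟩)
    rw [sum_union (Finset.disjoint_right.2 hYS),
      ← card_filter_add_card_filter_not (s := oddComps G (S ∪ Y)) (· ⊆ C)] at h_strict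
    have h_par := odd_card_sdiff_iff hC.closed (X := S ∪ Y) subset_union_left
    have h_sdiff : #(C \ (S ∪ Y)) + #Y = #C := by
      rw [← card_sdiff_add_card_inter C (S ∪ Y), inter_comm, ← hXZ]
    have h_Y := sum_add_card_inter hh hYS
    have h_gY := odd_sum_iff_odd_card hg Y
    have h_e : #((C ∩ e) \ X) + #(Y ∩ e) = #(C ∩ e) := by
      rw [← card_sdiff_add_card_inter (C ∩ e) X]
      congr 2
      ext a
      simp only [mem_inter, hYdef]
      tauto
    rw [← hP] at h_par h_strict
    refine h_odd.trans ?_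
    simp only [Nat.odd_iff] at h_par h_gY hCe h_rest
    split_ifs at hCe h_rest <;> omega

open Classical in
lemma card_filter_comps_le (hg : ∀ v, Odd (g v))
    (hmax : ∀ Y, S ⊂ Y → #(oddComps G Y) + ∑ v ∈ S, g v < #(oddComps G S) + ∑ v ∈ Y, g v)
    (he : ∀ C, IsComp G S C → #(C ∩ e) = if Odd #C then 1 else 0)
    (hh : ∀ v ∉ S, h v + (if v ∈ e then 1 else 0) = g v) (hSX : S ⊆ X) :
    #{K ∈ comps G X | Odd (∑ v ∈ K, h v)} ≤ ∑ v ∈ X, h v := by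
  calc #{K ∈ comps G X | Odd (∑ v ∈ K, h v)}
      ≤ #((comps G S).biUnion fun C => {K ∈ comps G X | K ⊆ C ∧ Odd (∑ v ∈ K, h v)}) := by
        refine card_le_card fun K hK => ?_
        obtain ⟨hK, hodd⟩ := mem_filter.1 hK
        obtain ⟨a, ha⟩ := (mem_comps.1 hK).nonempty
        obtain ⟨C, hC, haC⟩ := exists_isComp_mem (G := G)
          fun h => (mem_comps.1 hK).disjoint a ha (hSX h)
        refine mem_biUnion.2 ⟨C, mem_comps.2 hC, mem_filter.2 ⟨hK, ?_, hodd⟩⟩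
        exact (mem_comps.1 hK).subset_of_isClosedOff
          (fun a ha b hb => hC.closed a ha b fun h => hb (hSX h)) ha haC
    _ ≤ ∑ C ∈ comps G S, #{K ∈ comps G X | K ⊆ C ∧ Odd (∑ v ∈ K, h v)} := card_biUnion_le
    _ ≤ ∑ C ∈ comps G S, ∑ v ∈ X ∩ C, h v := sum_le_sum fun C hC =>
        card_filter_comps_subset_le hg hmax he hh hSX (mem_comps.1 hC)
    _ = ∑ v ∈ (comps G S).biUnion fun C => X ∩ C, h v := by
        refine (sum_biUnion ?_).symm
        intro C hC D hD hCD
        rw [mem_coe, mem_comps] at hC hD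
        refine Finset.disjoint_left.2 fun a ha hb => hCD ?_
        exact hC.eq_of_mem hD (mem_inter.1 ha).2 (mem_inter.1 hb).2
    _ ≤ ∑ v ∈ X, h v :=
        sum_le_sum_of_subset (biUnion_subset.2 fun C _ => inter_subset_left)

end Barrier

lemma eq_univ_of_isClosedOff_empty (hG : G.Connected) (hC : C.Nonempty)
    (hcl : IsClosedOff G ∅ C) : C = univ := by
  obtain ⟨x, hx⟩ := hC
  refine eq_univ_iff_forall.2 fun y => ?_
  obtain ⟨p⟩ := hG.preconnected x y
  induction p with
  | nil => exact hx
  | cons h _ ih => exact ih (hcl _ hx _ (notMem_empty _) h)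

lemma IsComp.exists_adj (hG : G.Connected) {S : Finset V} (hS : S.Nonempty) (hC : IsComp G S C) :
    ∃ v ∈ S, ∃ c ∈ C, G.Adj v c := by
  by_contra! h
  have h1 : C = univ := eq_univ_of_isClosedOff_empty hG hC.nonempty fun a ha b _ hab => by
    by_cases hb : b ∈ S
    · exact absurd hab.symm (h b hb a ha)
    · exact hC.closed a ha b hb hab
  obtain ⟨s, hs⟩ := hS
  exact hC.disjoint s (h1 ▸ mem_univ s) hs

section Assignment

variable {S : Finset V} {f g : V → ℕ}

open Classical in
/-- The vertices of `S` with a neighbour in some member of `Y`. -/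
noncomputable def attached (G : SimpleGraph V) (S : Finset V) (Y : Finset (Finset V)) : Finset V :=
  {v ∈ S | ∃ C ∈ Y, ∃ c ∈ C, G.Adj v c}

lemma mem_attached {Y : Finset (Finset V)} :
    v ∈ attached G S Y ↔ v ∈ S ∧ ∃ C ∈ Y, ∃ c ∈ C, G.Adj v c := by
  simp [attached]

lemma card_le_card_oddComps_attached {Y : Finset (Finset V)} (hY : Y ⊆ oddComps G S) :
    #Y ≤ #(oddComps G (attached G S Y)) := by
  refine card_le_card fun C hCY => ?_
  obtain ⟨hC, hodd⟩ := mem_oddComps.1 (hY hCY)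
  have hsub : ∀ b, b ∉ S → b ∉ attached G S Y := fun b hb h => hb (mem_attached.1 h).1
  refine mem_oddComps.2 ⟨⟨hC.nonempty, fun a ha => hsub a (hC.disjoint a ha), ?_, ?_⟩, hodd⟩
  · intro a ha b hb hab
    by_cases hbS : b ∈ S
    · exact absurd (mem_attached.2 ⟨hbS, C, hCY, a, ha, hab.symm⟩) hb
    · exact hC.closed a ha b hbS hab
  · exact fun L hL hLn hLc => hC.minimal L hL hLn fun a ha b hb => hLc a ha b (hsub b hb)

open Classical in
/-- The odd components of `G - S` can be assigned to adjacent vertices of `S` so that each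
`v ∈ S` receives `g v` or `g v + 1` of them. -/
lemma exists_assignment (hG : G.Connected) (hS : S.Nonempty) (hfg : ∀ v, f v = g v + 1)
    (hcond : ∀ Y : Finset V, Y.Nonempty → #(oddComps G Y) ≤ ∑ v ∈ Y, f v)
    (hmax : ∀ Y, #(oddComps G Y) + ∑ v ∈ S, g v ≤ #(oddComps G S) + ∑ v ∈ Y, g v) :
    ∃ φ : Finset V → V, (∀ C ∈ oddComps G S, φ C ∈ S ∧ ∃ c ∈ C, G.Adj (φ C) c) ∧
      ∀ v ∈ S, #{C ∈ oddComps G S | φ C = v} = g v ∨ #{C ∈ oddComps G S | φ C = v} = f v := by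
  set O := oddComps G S with hO
  set q := ∑ v ∈ S, f v - #O with hq
  have hOf : #O ≤ ∑ v ∈ S, f v := hcond S hS
  have hfS : ∑ v ∈ S, f v = ∑ v ∈ S, g v + #S := by
    simp only [hfg, sum_add_distrib, card_eq_sum_ones]
  let t : {C // C ∈ O} ⊕ Fin q → Finset (Σ _ : V, ℕ) :=
    Sum.elim (fun C => (attached G S {C.1}).sigma fun v => range (f v))
      (fun _ => S.sigma fun _ => {0})
  have hall : ∀ s : Finset ({C // C ∈ O} ⊕ Fin q), #s ≤ #(s.biUnion t) := by
    intro s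
    set Y : Finset (Finset V) := s.toLeft.map (Function.Embedding.subtype _) with hYdef
    have hYO : Y ⊆ O := by
      intro C hC
      obtain ⟨D, -, rfl⟩ := mem_map.1 hC
      exact D.2
    have hsY : #s = #Y + #s.toRight := by
      rw [← card_toLeft_add_card_toRight, hYdef, card_map]
    have hY := card_le_card_oddComps_attached hYO
    have hsub : ∀ v ∈ attached G S Y, ∀ i < f v, (⟨v, i⟩ : Σ _ : V, ℕ) ∈ s.biUnion t := by
      intro v hv i hi
      obtain ⟨hvS, C, hCY, hadj⟩ := mem_attached.1 hv
      obtain ⟨D, hD, rfl⟩ := mem_map.1 hCY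
      refine mem_biUnion.2 ⟨Sum.inl D, mem_toLeft.1 hD, ?_⟩
      exact mem_sigma.2 ⟨mem_attached.2 ⟨hvS, _, mem_singleton_self _, hadj⟩, mem_range.2 hi⟩
    rcases s.toRight.eq_empty_or_nonempty with hR | ⟨r, hr⟩
    · rw [hsY, hR, card_empty, add_zero]
      rcases Y.eq_empty_or_nonempty with hY0 | ⟨C, hC⟩
      · simp [hY0]
      have hne : (attached G S Y).Nonempty := by
        obtain ⟨v, hv, hvC⟩ := (mem_oddComps.1 (hYO hC)).1.exists_adj hG hS
        exact ⟨v, mem_attached.2 ⟨hv, C, hC, hvC⟩⟩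
      calc #Y ≤ ∑ v ∈ attached G S Y, f v := hY.trans (hcond _ hne)
        _ = #((attached G S Y).sigma fun v => range (f v)) := by simp [card_sigma]
        _ ≤ _ := card_le_card fun x hx => by
          obtain ⟨h1, h2⟩ := mem_sigma.1 hx
          exact hsub x.1 h1 x.2 (mem_range.1 h2)
    · have h1 : #s.toRight ≤ q := by simpa using card_le_univ s.toRight
      have h2 := hmax (attached G S Y)
      calc #s ≤ #S + ∑ v ∈ attached G S Y, g v := by omega
        _ = #((S.sigma fun _ => ({0} : Finset ℕ)) ∪
            (attached G S Y).sigma fun v => Ico 1 (f v)) := by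
          rw [card_union_of_disjoint]
          · simp [card_sigma, hfg]
          · rw [Finset.disjoint_left]
            intro x hx hx'
            simp only [mem_sigma, mem_singleton, mem_Ico] at hx hx'
            omega
        _ ≤ _ := card_le_card fun x hx => by
          rcases mem_union.1 hx with hx | hx
          · exact mem_biUnion.2 ⟨Sum.inr r, mem_toRight.1 hr, hx⟩
          · obtain ⟨h1, h2⟩ := mem_sigma.1 hx
            exact hsub x.1 h1 x.2 (mem_Ico.1 h2).2
  obtain ⟨η, hη, hηt⟩ := (all_card_le_biUnion_card_iff_exists_injective t).1 hall
  have hl : ∀ C : {C // C ∈ O}, (η (Sum.inl C)).1 ∈ attached G S {C.1} ∧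
      (η (Sum.inl C)).2 < f (η (Sum.inl C)).1 := fun C => by
    simpa [t] using hηt (Sum.inl C)
  have hr : ∀ i, (η (Sum.inr i)).1 ∈ S ∧ (η (Sum.inr i)).2 = 0 := fun i => by
    simpa [t] using hηt (Sum.inr i)
  have himage : univ.image η = S.sigma fun v => range (f v) := by
    refine eq_of_subset_of_card_le (image_subset_iff.2 ?_) ?_
    · rintro (C | i) -
      · exact mem_sigma.2 ⟨(mem_attached.1 (hl C).1).1, mem_range.2 (hl C).2⟩
      · refine mem_sigma.2 ⟨(hr i).1, mem_range.2 ?_⟩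
        rw [(hr i).2, hfg]
        omega
    · rw [card_image_of_injective _ hη]
      simp only [card_sigma, card_range, card_univ, Fintype.card_sum, Fintype.card_coe,
        Fintype.card_fin]
      omega
  obtain ⟨s₀, -⟩ := hS
  refine ⟨fun C => if h : C ∈ O then (η (Sum.inl ⟨C, h⟩)).1 else s₀, fun C hC => ?_,
    fun v hv => ?_⟩
  · simp only [hC, dif_pos]
    obtain ⟨h1, D, hD, h2⟩ := mem_attached.1 (hl ⟨C, hC⟩).1
    rw [mem_singleton.1 hD] at h2
    exact ⟨h1, h2⟩
  · set A := {C ∈ O | (if h : C ∈ O then (η (Sum.inl ⟨C, h⟩)).1 else s₀) = v} with hA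
    have h1 : #A ≤ #(range (f v)) := by
      refine card_le_card_of_forall_subsingleton
        (fun C i => ∃ h : C ∈ O, η (Sum.inl ⟨C, h⟩) = ⟨v, i⟩) ?_ ?_
      · intro C hC
        obtain ⟨hCO, hCv⟩ := mem_filter.1 hC
        rw [dif_pos hCO] at hCv
        refine ⟨(η (Sum.inl ⟨C, hCO⟩)).2, mem_range.2 ?_, hCO, ?_⟩
        · simpa only [hCv] using (hl ⟨C, hCO⟩).2
        · rw [← hCv]
      · rintro i - C ⟨-, hC, hCi⟩ D ⟨-, hD, hDi⟩
        simpa using hη (hCi.trans hDi.symm)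
    have h2 : #(Ico 1 (f v)) ≤ #A := by
      refine card_le_card_of_forall_subsingleton
        (fun i C => ∃ h : C ∈ O, η (Sum.inl ⟨C, h⟩) = ⟨v, i⟩) ?_ ?_
      · intro i hi
        rw [mem_Ico] at hi
        have : (⟨v, i⟩ : Σ _ : V, ℕ) ∈ univ.image η := by
          rw [himage]
          exact mem_sigma.2 ⟨hv, mem_range.2 hi.2⟩
        obtain ⟨C | j, -, hx⟩ := mem_image.1 this
        · refine ⟨C.1, mem_filter.2 ⟨C.2, ?_⟩, C.2, hx⟩
          rw [dif_pos C.2, hx]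
        · have := (hr j).2
          rw [hx] at this
          simp only at this
          omega
      · rintro C - i ⟨-, hC, hCi⟩ j ⟨-, hC', hCj⟩
        simpa using hCi.symm.trans hCj
    rw [card_range] at h1
    rw [Nat.card_Ico] at h2
    have := hfg v
    omega

end Assignment

section Degrees

variable {F M : SimpleGraph V} {u w : V}

lemma ndeg_sup (h : ∀ u, F.Adj v u → ¬ M.Adj v u) : ndeg (F ⊔ M) v = ndeg F v + ndeg M v := by
  simp only [ndeg, Nat.card_coe_set_eq]
  exact Set.ncard_union_eq (s := F.neighborSet v) (t := M.neighborSet v) (Set.disjoint_left.2 h)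

lemma ndeg_eq_zero_iff : ndeg F v = 0 ↔ ∀ u, ¬ F.Adj v u := by
  rw [ndeg, Nat.card_coe_set_eq, Set.ncard_eq_zero, Set.eq_empty_iff_forall_notMem]
  rfl

lemma ndeg_eq_one (h : ∀ x, F.Adj v x ↔ x = u) : ndeg F v = 1 := by
  have : F.neighborSet v = {u} := Set.ext h
  rw [ndeg, Nat.card_coe_set_eq, this, Set.ncard_singleton]

lemma exists_adj_not_adj (h : ndeg F v < ndeg G v) : ∃ u, G.Adj v u ∧ ¬ F.Adj v u := by
  by_contra! hc
  refine h.not_ge ?_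
  simp only [ndeg, Nat.card_coe_set_eq]
  exact Set.ncard_le_ncard hc

/-- A spanning subgraph violating the degree constraints only by a too small even degree at one
vertex can be completed, by adding edges one at a time. -/
lemma exists_factor_of_even_vertex {f : V → ℕ} (hfe : ∀ v, Even (f v)) (hf : ∀ v, 2 ≤ f v)
    (hdeg : ∀ v, f v - 1 ≤ ndeg G v) (F : SimpleGraph V) (hFG : F ≤ G) (u : V)
    (hu : Even (ndeg F u)) (hu' : ndeg F u + 2 ≤ f u)
    (hodd : ∀ v ≠ u, Odd (ndeg F v) ∧ ndeg F v ≤ f v - 1) :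
    ∃ F : SimpleGraph V, F ≤ G ∧
      ∀ v : V, (Odd (ndeg F v) ∧ ndeg F v ≤ f v - 1) ∨ ndeg F v = f v := by
  induction F using WellFoundedGT.induction generalizing u with
  | ind F ih =>
    obtain ⟨w, hG, hF⟩ := exists_adj_not_adj (F := F) (G := G) (v := u)
      (by have := hdeg u; omega)
    have huw := hG.ne
    have hsup : ∀ v, ndeg (F ⊔ edge u w) v = ndeg F v + ndeg (edge u w) v := by
      refine fun v => ndeg_sup fun x hx hx' => ?_
      rcases (edge_adj ..).1 hx' with ⟨⟨rfl, rfl⟩ | ⟨rfl, rfl⟩, -⟩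
      · exact hF hx
      · exact hF hx.symm
    have h_u : ndeg (F ⊔ edge u w) u = ndeg F u + 1 := by
      rw [hsup, ndeg_eq_one (F := edge u w) (u := w)]
      intro x
      rw [edge_adj]
      grind
    have h_w : ndeg (F ⊔ edge u w) w = ndeg F w + 1 := by
      rw [hsup, ndeg_eq_one (F := edge u w) (u := u)]
      intro x
      rw [edge_adj]
      grind
    have h_other : ∀ v, v ≠ u → v ≠ w → ndeg (F ⊔ edge u w) v = ndeg F v := by
      intro v hvu hvw
      rw [hsup, ndeg_eq_zero_iff (F := edge u w).2, add_zero]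
      intro x
      rw [edge_adj]
      grind
    have hle : F ⊔ edge u w ≤ G := sup_le hFG (by rw [edge_le_iff]; exact Or.inr hG)
    have hlt : F < F ⊔ edge u w := by
      refine lt_of_le_of_ne le_sup_left fun h => hF ?_
      rw [h]
      exact Or.inr ((edge_adj ..).2 ⟨Or.inl ⟨rfl, rfl⟩, huw⟩)
    have hw := hodd w huw.symm
    have hfu := hfe u
    have hfw := hfe w
    have hfw2 := hf w
    rw [Nat.even_iff] at hu hfu hfw
    rw [Nat.odd_iff] at hw
    have hu_ok : Odd (ndeg (F ⊔ edge u w) u) ∧ ndeg (F ⊔ edge u w) u ≤ f u - 1 := by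
      rw [h_u, Nat.odd_iff]
      omega
    by_cases hwf : ndeg F w = f w - 1
    · refine ⟨F ⊔ edge u w, hle, fun v => ?_⟩
      by_cases hvw : v = w
      · subst hvw
        right
        omega
      · left
        by_cases hvu : v = u
        · exact hvu ▸ hu_ok
        · rw [h_other v hvu hvw]
          exact hodd v hvu
    · refine ih _ hlt hle w ?_ ?_ fun v hvw => ?_
      · rw [h_w, Nat.even_iff]
        omega
      · omega
      · by_cases hvu : v = u
        · exact hvu ▸ hu_ok
        · rw [h_other v hvu hvw]
          exact hodd v hvu

end Degrees

/-- A set maximizing `o(G - S) - g(S)` and, among those, of maximal cardinality. -/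
lemma exists_maximal_barrier (G : SimpleGraph V) (g : V → ℕ) : ∃ S : Finset V,
    (∀ Y, #(oddComps G Y) + ∑ v ∈ S, g v ≤ #(oddComps G S) + ∑ v ∈ Y, g v) ∧
    ∀ Y, S ⊂ Y → #(oddComps G Y) + ∑ v ∈ S, g v < #(oddComps G S) + ∑ v ∈ Y, g v := by
  classical
  let p : Finset V → ℤ := fun S => #(oddComps G S) - ∑ v ∈ S, (g v : ℤ)
  obtain ⟨S₀, -, hS₀⟩ := exists_max_image univ p univ_nonempty
  obtain ⟨S, hS, hScard⟩ := exists_max_image {S | p S = p S₀} card ⟨S₀, by simp⟩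
  have hpS : p S = p S₀ := by simpa using hS
  have hmax : ∀ Y, p Y ≤ p S := fun Y => hpS ▸ hS₀ Y (mem_univ _)
  refine ⟨S, fun Y => ?_, fun Y hSY => ?_⟩
  · have := hmax Y
    simp only [p] at this
    zify
    linarith
  · have h1 : p Y ≠ p S := fun h => (card_lt_card hSY).not_ge
      (hScard Y (by simp [h, hpS]))
    have := lt_of_le_of_ne (hmax Y) h1
    simp only [p] at this
    zify
    linarith

open Classical in
lemma exists_factor_of_barrier_empty (hG : G.Connected)
    (hodd : Odd (Fintype.card V)) {f : V → ℕ} (hfe : ∀ v, Even (f v)) (hf : ∀ v, 2 ≤ f v)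
    (hdeg : ∀ v, f v - 1 ≤ ndeg G v)
    (hmax : ∀ Y : Finset V, ∅ ⊂ Y → #(oddComps G Y) + ∑ v ∈ (∅ : Finset V), (f v - 1) <
      #(oddComps G ∅) + ∑ v ∈ Y, (f v - 1)) :
    ∃ F : SimpleGraph V, F ≤ G ∧
      ∀ v : V, (Odd (ndeg F v) ∧ ndeg F v ≤ f v - 1) ∨ ndeg F v = f v := by
  obtain ⟨u⟩ := hG.nonempty
  let h : V → ℕ := fun v => f v - 1 - if v = u then 1 else 0
  have hg : ∀ v, Odd (f v - 1) := fun v => Nat.Even.sub_odd (by have := hf v; omega) (hfe v) odd_one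
  obtain ⟨F, hFG, hF⟩ := exists_parity_factor G h fun X _ =>
    card_filter_comps_le (S := ∅) (e := {u}) hg hmax (by
      intro C hC
      obtain rfl := eq_univ_of_isClosedOff_empty hG hC.nonempty hC.closed
      rw [univ_inter, card_singleton, card_univ, if_pos hodd]) (by
      intro v _
      have := hf v
      simp only [h, mem_singleton]
      split_ifs <;> omega) (empty_subset X)
  refine exists_factor_of_even_vertex hfe hf hdeg F hFG u ?_ ?_ fun v hv => ?_
  · have h1 := (hF u).2
    have h2 := hfe u
    have h3 := hf u
    simp only [h, if_pos, Nat.odd_iff, Nat.even_iff] at h1 h2 ⊢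
    omega
  · have h1 := (hF u).1
    have h3 := hf u
    simp only [h, if_pos] at h1
    omega
  · have h1 := hF v
    simp only [h, if_neg hv, Nat.sub_zero] at h1
    exact ⟨h1.2.2 (hg v), h1.1⟩

open Classical in
lemma exists_factor_of_barrier_nonempty (hG : G.Connected) {f : V → ℕ} (hfe : ∀ v, Even (f v))
    (hf : ∀ v, 2 ≤ f v) {S : Finset V} (hS : S.Nonempty)
    (hcond : ∀ Y : Finset V, Y.Nonempty → #(oddComps G Y) ≤ ∑ v ∈ Y, f v)
    (hle : ∀ Y, #(oddComps G Y) + ∑ v ∈ S, (f v - 1) ≤ #(oddComps G S) + ∑ v ∈ Y, (f v - 1))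
    (hmax : ∀ Y, S ⊂ Y →
      #(oddComps G Y) + ∑ v ∈ S, (f v - 1) < #(oddComps G S) + ∑ v ∈ Y, (f v - 1)) :
    ∃ F : SimpleGraph V, F ≤ G ∧
      ∀ v : V, (Odd (ndeg F v) ∧ ndeg F v ≤ f v - 1) ∨ ndeg F v = f v := by
  have hg : ∀ v, Odd (f v - 1) := fun v => Nat.Even.sub_odd (by have := hf v; omega) (hfe v) odd_one
  obtain ⟨φ, hφ, hφcard⟩ := exists_assignment (g := fun v => f v - 1) hG hS
    (fun v => by have := hf v; omega) hcond hle
  set O := oddComps G S with hO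
  obtain ⟨s₀, -⟩ := hS
  have hc : ∀ C, ∃ c, C ∈ O → c ∈ C ∧ G.Adj (φ C) c := fun C => by
    by_cases hC : C ∈ O
    · obtain ⟨c, hc⟩ := (hφ C hC).2
      exact ⟨c, fun _ => hc⟩
    · exact ⟨s₀, fun h => absurd h hC⟩
  choose c hc using hc
  have hcS : ∀ C ∈ O, c C ∉ S := fun C hC => (mem_oddComps.1 hC).1.disjoint _ (hc C hC).1
  have hcinj : ∀ C ∈ O, ∀ D, IsComp G S D → c C ∈ D → C = D := fun C hC D hD hcD =>
    (mem_oddComps.1 hC).1.eq_of_mem hD (hc C hC).1 hcD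
  set e := O.image c with he
  let h : V → ℕ := fun v => if v ∈ S then 0 else f v - 1 - if v ∈ e then 1 else 0
  obtain ⟨F, hFG, hF⟩ := exists_parity_factor G h fun X hX =>
    card_filter_comps_le (S := S) (e := e) hg hmax (by
      intro C hC
      split_ifs with hodd
      · have hCO : C ∈ O := mem_oddComps.2 ⟨hC, hodd⟩
        rw [card_eq_one]
        refine ⟨c C, ?_⟩
        ext x
        rw [mem_inter, mem_singleton]
        constructor
        · rintro ⟨hxC, hxe⟩
          obtain ⟨D, hD, rfl⟩ := mem_image.1 hxe
          rw [hcinj D hD C hC hxC]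
        · rintro rfl
          exact ⟨(hc C hCO).1, mem_image_of_mem _ hCO⟩
      · rw [card_eq_zero, eq_empty_iff_forall_notMem]
        intro x hx
        rw [mem_inter] at hx
        obtain ⟨D, hD, rfl⟩ := mem_image.1 hx.2
        exact hodd (hcinj D hD C hC hx.1 ▸ (mem_oddComps.1 hD).2)) (by
      intro v hv
      have := hf v
      simp only [h, if_neg hv]
      split_ifs <;> omega) (fun v hv => hX v (by simp [h, hv]))
  let M : SimpleGraph V :=
    { Adj := fun a b => ∃ C ∈ O, (a = φ C ∧ b = c C) ∨ (a = c C ∧ b = φ C)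
      symm := ⟨fun a b ⟨C, hC, h⟩ => ⟨C, hC, h.symm.imp And.symm And.symm⟩⟩
      loopless := ⟨fun a ⟨C, hC, h⟩ => (hc C hC).2.ne (by
        rcases h with h | h
        · exact h.1.symm.trans h.2
        · exact h.2.symm.trans h.1)⟩ }
  have hM : ∀ a b, M.Adj a b ↔ ∃ C ∈ O, (a = φ C ∧ b = c C) ∨ (a = c C ∧ b = φ C) :=
    fun _ _ => Iff.rfl
  have hFS : ∀ v ∈ S, ndeg F v = 0 := fun v hv => by
    have := (hF v).1
    simpa [h, hv] using this
  have hsup : ∀ v, ndeg (F ⊔ M) v = ndeg F v + ndeg M v := by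
    refine fun v => ndeg_sup fun u hvu hM' => ?_
    obtain ⟨C, hC, ⟨rfl, rfl⟩ | ⟨rfl, rfl⟩⟩ := (hM _ _).1 hM'
    · exact ndeg_eq_zero_iff.1 (hFS _ (hφ C hC).1) _ hvu
    · exact ndeg_eq_zero_iff.1 (hFS _ (hφ C hC).1) _ hvu.symm
  refine ⟨F ⊔ M, sup_le hFG ?_, fun v => ?_⟩
  · rintro a b hab
    obtain ⟨C, hC, ⟨rfl, rfl⟩ | ⟨rfl, rfl⟩⟩ := (hM _ _).1 hab
    · exact (hc C hC).2
    · exact (hc C hC).2.symm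
  rw [hsup]
  by_cases hv : v ∈ S
  · have hMv : ndeg M v = #{C ∈ O | φ C = v} := by
      have h1 : M.neighborSet v = (({C ∈ O | φ C = v}.image c : Finset V) : Set V) := by
        ext x
        rw [mem_neighborSet, hM]
        simp only [coe_image, Set.mem_image, mem_coe, mem_filter]
        constructor
        · rintro ⟨C, hC, ⟨rfl, rfl⟩ | ⟨rfl, -⟩⟩
          · exact ⟨C, ⟨hC, rfl⟩, rfl⟩
          · exact absurd hv (hcS C hC)
        · rintro ⟨C, ⟨hC, rfl⟩, rfl⟩
          exact ⟨C, hC, Or.inl ⟨rfl, rfl⟩⟩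
      rw [ndeg, Nat.card_coe_set_eq, h1, Set.ncard_coe_finset, card_image_of_injOn]
      intro C hC D hD hCD
      have hC := (mem_filter.1 hC).1
      have hD := (mem_filter.1 hD).1
      exact hcinj C hC D (mem_oddComps.1 hD).1 (by
        rw [show c C = c D from hCD]
        exact (hc D hD).1)
    rw [hFS v hv, zero_add, hMv]
    rcases hφcard v hv with h1 | h1
    · exact Or.inl ⟨h1 ▸ hg v, h1.le⟩
    · exact Or.inr h1
  · left
    have hMv : ndeg M v = if v ∈ e then 1 else 0 := by
      split_ifs with hve
      · obtain ⟨C, hC, rfl⟩ := mem_image.1 hve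
        refine ndeg_eq_one (u := φ C) fun x => ⟨?_, fun hx => ?_⟩
        · rw [hM]
          rintro ⟨D, hD, ⟨h1, -⟩ | ⟨h1, rfl⟩⟩
          · exact absurd (h1 ▸ (hφ D hD).1) hv
          · rw [hcinj C hC D (mem_oddComps.1 hD).1 (h1 ▸ (hc D hD).1)]
        · exact ⟨C, hC, Or.inr ⟨rfl, hx⟩⟩
      · rw [ndeg_eq_zero_iff]
        rintro x ⟨C, hC, ⟨rfl, -⟩ | ⟨rfl, -⟩⟩
        · exact hv (hφ C hC).1
        · exact hve (mem_image_of_mem _ hC)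
    have h1 := hF v
    have h2 := hf v
    have h3 := hg v
    simp only [h, if_neg hv] at h1
    rw [hMv]
    simp only [Nat.odd_iff] at h1 h3 ⊢
    split_ifs at h1 ⊢ <;> omega

end OddFactor

/-- Odd order: connected graph with `d_G(v) ≥ f(v)-1` and `o(G-S) ≤ f(S)` for all
nonempty `S` has an `H_f`-factor. -/
theorem stmt_3 {V : Type*} [Fintype V] (G : SimpleGraph V) (hconn : G.Connected)
    (hodd : Odd (Fintype.card V))
    (f : V → ℕ) (hfe : ∀ v, Even (f v)) (hf4 : ∀ v, 4 ≤ f v)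
    (hdeg : ∀ v, f v - 1 ≤ ndeg G v)
    (hcond : ∀ S : Finset V, S.Nonempty → oddComp G (↑S : Set V) ≤ ∑ v ∈ S, f v) :
    ∃ F : SimpleGraph V, F ≤ G ∧
      ∀ v : V, (Odd (ndeg F v) ∧ ndeg F v ≤ f v - 1) ∨ ndeg F v = f v := by
  have hf2 : ∀ v, 2 ≤ f v := fun v => le_trans (by norm_num) (hf4 v)
  have hcond' : ∀ Y : Finset V, Y.Nonempty → (OddFactor.oddComps G Y).card ≤ ∑ v ∈ Y, f v :=
    fun Y hY => OddFactor.oddComp_eq_card G Y ▸ hcond Y hY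
  obtain ⟨S, hle, hmax⟩ := OddFactor.exists_maximal_barrier G fun v => f v - 1
  rcases S.eq_empty_or_nonempty with rfl | hS
  · exact OddFactor.exists_factor_of_barrier_empty hconn hodd hfe hf2 hdeg hmax
  · exact OddFactor.exists_factor_of_barrier_nonempty hconn hfe hf2 hS hcond' hle hmax
end

section
/- Let n ≥ 2 be an integer and G a connected finite simple graph of odd order with minimum degree at least 2n−1. If o(G − S) ≤ 2n·|S| for every nonempty S ⊆ V(G), then G has a spanning subgraph F with d_F(v) ∈ {1, 3, ..., 2n−1, 2n} for every vertex v. -/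
open SimpleGraph

namespace SimpleGraph

open scoped symmDiff

variable {V : Type*}

lemma symmDiff_edge_adj (F : SimpleGraph V) {u x : V} (hux : u ≠ x) (a b : V) :
    (F ∆ edge u x).Adj a b ↔ ¬(F.Adj a b ↔ s(u, x) = s(a, b)) := by
  have hne : s(u, x) = s(a, b) → a ≠ b := by
    rintro h rfl
    rw [Sym2.eq_iff] at h
    grind
  simp only [symmDiff_def, sup_adj, sdiff_adj, adj_edge]
  tauto

lemma symmDiff_edge_le {F G : SimpleGraph V} (hF : F ≤ G) {u x : V} (h : G.Adj u x) :
    F ∆ edge u x ≤ G :=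
  symmDiff_le_sup.trans (sup_le hF ((edge_le_iff G).2 (Or.inr h)))

section Finite

variable [Fintype V]

omit [Fintype V] in
lemma ndeg_symmDiff_edge_of_ne (F : SimpleGraph V) {u x v : V} (hux : u ≠ x)
    (hvu : v ≠ u) (hvx : v ≠ x) : ndeg (F ∆ edge u x) v = ndeg F v := by
  have : (F ∆ edge u x).neighborSet v = F.neighborSet v := by
    ext b
    simp only [mem_neighborSet, symmDiff_edge_adj F hux, Sym2.eq_iff]
    grind
  rw [ndeg, ndeg, this]

lemma ndeg_symmDiff_edge_of_adj (F : SimpleGraph V) {u x : V} (h : F.Adj u x) :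
    ndeg (F ∆ edge u x) u + 1 = ndeg F u := by
  have : F.neighborSet u = insert x ((F ∆ edge u x).neighborSet u) := by
    ext b
    simp only [mem_neighborSet, symmDiff_edge_adj F h.ne, Sym2.eq_iff, Set.mem_insert_iff]
    grind
  rw [ndeg, ndeg, this, Nat.card_coe_set_eq, Nat.card_coe_set_eq,
    Set.ncard_insert_of_notMem _ (Set.toFinite _)]
  simp [symmDiff_edge_adj F h.ne, h]

lemma ndeg_symmDiff_edge_of_not_adj (F : SimpleGraph V) {u x : V} (hux : u ≠ x)
    (h : ¬F.Adj u x) : ndeg (F ∆ edge u x) u = ndeg F u + 1 := by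
  have : (F ∆ edge u x).neighborSet u = insert x (F.neighborSet u) := by
    ext b
    simp only [mem_neighborSet, symmDiff_edge_adj F hux, Sym2.eq_iff, Set.mem_insert_iff]
    grind
  rw [ndeg, ndeg, this, Nat.card_coe_set_eq, Nat.card_coe_set_eq,
    Set.ncard_insert_of_notMem _ (Set.toFinite _)]
  simpa using h

/-- A hole of `F` is a vertex whose degree is even and below `2n`. -/
def IsHole (n : ℕ) (F : SimpleGraph V) (v : V) : Prop :=
  Even (ndeg F v) ∧ ndeg F v < 2 * n

/-- `F` is a subgraph of `G` of maximum degree at most `2n` with as few holes as possible. -/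
structure IsOptimal (G : SimpleGraph V) (n : ℕ) (F : SimpleGraph V) : Prop where
  le : F ≤ G
  ndeg_le : ∀ v, ndeg F v ≤ 2 * n
  min : ∀ F' ≤ G, (∀ v, ndeg F' v ≤ 2 * n) →
    {v | IsHole n F v}.ncard ≤ {v | IsHole n F' v}.ncard

variable {G F F' : SimpleGraph V} {n : ℕ}

/-- Changing the parity of the degrees of a hole `u` and of one other vertex `x` moves the hole
from `u` to `x`. -/
lemma IsOptimal.of_parity (hF : IsOptimal G n F) {u x : V} (hu : IsHole n F u) (hux : u ≠ x)
    (hle : F' ≤ G) (hu' : Odd (ndeg F' u)) (hu_le : ndeg F' u ≤ 2 * n)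
    (hx : Even (ndeg F' x) ↔ Odd (ndeg F x)) (hx_le : ndeg F' x ≤ 2 * n)
    (hne : ∀ v, v ≠ u → v ≠ x → ndeg F' v = ndeg F v) :
    IsOptimal G n F' ∧ IsHole n F' x ∧ Odd (ndeg F x) := by
  have hbdd : ∀ v, ndeg F' v ≤ 2 * n := by
    intro v
    by_cases hvu : v = u
    · exact hvu ▸ hu_le
    by_cases hvx : v = x
    · exact hvx ▸ hx_le
    exact (hne v hvu hvx).trans_le (hF.ndeg_le v)
  have hu_not : ¬IsHole n F' u := fun h => (Nat.not_even_iff_odd.2 hu') h.1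
  have hole : IsHole n F' x := by
    by_contra hx'
    refine (hF.min F' hle hbdd).not_gt (Set.ncard_lt_ncard ?_ (Set.toFinite _))
    rw [Set.ssubset_iff_of_subset]
    · exact ⟨u, hu, hu_not⟩
    · intro v hv
      have hvu : v ≠ u := by rintro rfl; exact hu_not hv
      have hvx : v ≠ x := by rintro rfl; exact hx' hv
      simpa [IsHole, hne v hvu hvx] using hv
  have hxodd := hx.1 hole.1
  refine ⟨⟨hle, hbdd, fun F₂ h1 h2 => le_trans ?_ (hF.min F₂ h1 h2)⟩, hole, hxodd⟩
  have hsub : {v | IsHole n F' v} ⊆ insert x ({v | IsHole n F v} \ {u}) := by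
    intro v hv
    by_cases hvx : v = x
    · exact Or.inl hvx
    have hvu : v ≠ u := by rintro rfl; exact hu_not hv
    refine Or.inr ⟨?_, hvu⟩
    simpa [IsHole, hne v hvu hvx] using hv
  refine (Set.ncard_le_ncard hsub (Set.toFinite _)).trans ((Set.ncard_insert_le _ _).trans ?_)
  exact (Set.ncard_sdiff_singleton_add_one (s := {v | IsHole n F v}) hu (Set.toFinite _)).le

/-- A hole moves along every edge, except along an unused edge to a vertex of degree `2n`. -/
lemma IsOptimal.toggle (hF : IsOptimal G n F) {u x : V} (hu : IsHole n F u) (hux : G.Adj u x)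
    (h : F.Adj u x ∨ ndeg F x ≠ 2 * n) :
    IsOptimal G n (F ∆ edge u x) ∧ IsHole n (F ∆ edge u x) x ∧ Odd (ndeg F x) := by
  have hx2 := hF.ndeg_le x
  obtain ⟨hu_even, hu_lt⟩ := hu
  have hne := hux.ne
  by_cases hadj : F.Adj u x
  · have h1 := ndeg_symmDiff_edge_of_adj F hadj
    have h2 := ndeg_symmDiff_edge_of_adj F hadj.symm
    rw [edge_comm] at h2
    exact hF.of_parity ⟨hu_even, hu_lt⟩ hne (symmDiff_edge_le hF.le hux) (by grind) (by omega)
      (by grind) (by omega) (fun v => ndeg_symmDiff_edge_of_ne F hne)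
  · have h1 := ndeg_symmDiff_edge_of_not_adj F hne hadj
    have h2 := ndeg_symmDiff_edge_of_not_adj F hne.symm (fun h => hadj h.symm)
    rw [edge_comm] at h2
    have h3 := h.resolve_left hadj
    exact hF.of_parity ⟨hu_even, hu_lt⟩ hne (symmDiff_edge_le hF.le hux) (by grind) (by omega)
      (by grind) (by omega) (fun v => ndeg_symmDiff_edge_of_ne F hne)

/-- A hole moves along a path of length two through a vertex of degree `2n` whose first edge is
unused and whose second edge is used. -/
lemma IsOptimal.swap (hF : IsOptimal G n F) {x s y : V} (hx : IsHole n F x) (hs : ndeg F s = 2 * n)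
    (hxs : G.Adj x s) (hsy : F.Adj s y) :
    ¬F.Adj x s ∧ y ≠ x ∧ IsOptimal G n ((F ∆ edge x s) ∆ edge s y) ∧
      IsHole n ((F ∆ edge x s) ∆ edge s y) y ∧ Odd (ndeg F y) := by
  have hn : ¬F.Adj x s := by
    intro h
    have := (hF.toggle hx hxs (Or.inl h)).2.2
    rw [hs] at this
    grind
  have hyx : y ≠ x := by
    rintro rfl
    exact hn hsy.symm
  refine ⟨hn, hyx, ?_⟩
  obtain ⟨hx_even, hx_lt⟩ := hx
  have hxs' := hxs.ne
  have hsy' := hsy.ne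
  have hadj : (F ∆ edge x s).Adj s y := by
    rw [symmDiff_edge_adj F hxs', Sym2.eq_iff]
    grind
  have h1 := ndeg_symmDiff_edge_of_not_adj F hxs' hn
  have h2 := ndeg_symmDiff_edge_of_not_adj F hxs'.symm (fun h => hn h.symm)
  rw [edge_comm] at h2
  have h3 := ndeg_symmDiff_edge_of_adj _ hadj
  have h4 := ndeg_symmDiff_edge_of_adj _ hadj.symm
  rw [edge_comm y s] at h4
  have h5 := ndeg_symmDiff_edge_of_ne F hxs' hyx hsy'.symm
  have h6 := ndeg_symmDiff_edge_of_ne (F ∆ edge x s) hsy' hxs' hyx.symm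
  have hy := hF.ndeg_le y
  refine hF.of_parity ⟨hx_even, hx_lt⟩ hyx.symm
    (symmDiff_edge_le (symmDiff_edge_le hF.le hxs) (hF.le hsy)) (by grind) (by omega)
    (by grind) (by omega) fun v hvx hvy => ?_
  by_cases hvs : v = s
  · subst hvs; omega
  · rw [ndeg_symmDiff_edge_of_ne _ hsy' hvs hvy, ndeg_symmDiff_edge_of_ne _ hxs' hvx hvs]

/-- The graph obtained from `G` by isolating the vertices in `Φ`. -/
def isolate (G : SimpleGraph V) (Φ : Set V) : SimpleGraph V where
  Adj a b := G.Adj a b ∧ a ∉ Φ ∧ b ∉ Φ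
  symm := ⟨fun _ _ h => ⟨h.1.symm, h.2.2, h.2.1⟩⟩
  loopless := ⟨fun _ h => h.1.ne rfl⟩

omit [Fintype V] in
lemma Reachable.isolate_notMem {Φ : Set V} {u z : V} (h : (isolate G Φ).Reachable u z)
    (hu : u ∉ Φ) : z ∉ Φ := by
  obtain ⟨p⟩ := h
  induction p with
  | nil => exact hu
  | cons h _ ih => exact ih h.2.2

/-- An optimal subgraph whose vertices of degree `2n` are those in `Φ`. -/
structure IsOptimalFull (G : SimpleGraph V) (n : ℕ) (Φ : Set V) (F : SimpleGraph V) : Prop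
    extends IsOptimal G n F where
  full : ∀ v, ndeg F v = 2 * n ↔ v ∈ Φ

variable {Φ : Set V}

omit [Fintype V] in
lemma IsOptimalFull.notMem (hF : IsOptimalFull G n Φ F) {u : V} (hu : IsHole n F u) : u ∉ Φ :=
  fun h => hu.2.ne ((hF.full u).2 h)

omit [Fintype V] in
lemma IsOptimalFull.notMem_of_odd (hF : IsOptimalFull G n Φ F) {u : V} (hu : Odd (ndeg F u)) :
    u ∉ Φ := by
  intro h
  rw [(hF.full u).2 h] at hu
  grind

lemma IsOptimalFull.toggle (hF : IsOptimalFull G n Φ F) {u x : V} (hu : IsHole n F u)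
    (hux : (isolate G Φ).Adj u x) :
    IsOptimalFull G n Φ (F ∆ edge u x) ∧ IsHole n (F ∆ edge u x) x ∧ Odd (ndeg F x) := by
  obtain ⟨hadj, huΦ, hxΦ⟩ := hux
  obtain ⟨h1, h2, h3⟩ := hF.toIsOptimal.toggle hu hadj (Or.inr fun h => hxΦ ((hF.full x).1 h))
  refine ⟨⟨h1, fun v => ?_⟩, h2, h3⟩
  by_cases hvx : v = x
  · subst hvx
    exact ⟨fun h => absurd h h2.2.ne, fun h => absurd h hxΦ⟩
  by_cases hvu : v = u
  · subst hvu
    refine ⟨fun h => ?_, fun h => absurd h huΦ⟩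
    have := hu.1
    by_cases hF' : F.Adj v x
    · have := ndeg_symmDiff_edge_of_adj F hF'
      grind
    · have := ndeg_symmDiff_edge_of_not_adj F hadj.ne hF'
      grind
  rw [ndeg_symmDiff_edge_of_ne F hadj.ne hvu hvx, hF.full]

lemma IsOptimalFull.swap (hF : IsOptimalFull G n Φ F) {x s y : V} (hx : IsHole n F x) (hs : s ∈ Φ)
    (hxs : G.Adj x s) (hsy : F.Adj s y) :
    IsOptimalFull G n Φ ((F ∆ edge x s) ∆ edge s y) ∧
      IsHole n ((F ∆ edge x s) ∆ edge s y) y ∧ y ∉ Φ := by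
  obtain ⟨hn, hyx, h1, h2, h3⟩ := hF.toIsOptimal.swap hx ((hF.full s).2 hs) hxs hsy
  have hyΦ := hF.notMem_of_odd h3
  refine ⟨⟨h1, fun v => ?_⟩, h2, hyΦ⟩
  have hadj : (F ∆ edge x s).Adj s y := by
    rw [symmDiff_edge_adj F hxs.ne, Sym2.eq_iff]
    grind
  by_cases hvy : v = y
  · subst hvy
    exact ⟨fun h => absurd h h2.2.ne, fun h => absurd h hyΦ⟩
  by_cases hvx : v = x
  · subst hvx
    refine ⟨fun h => ?_, fun h => absurd h (hF.notMem hx)⟩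
    rw [ndeg_symmDiff_edge_of_ne _ hsy.ne hxs.ne hyx.symm,
      ndeg_symmDiff_edge_of_not_adj F hxs.ne hn] at h
    have := hx.1
    grind
  by_cases hvs : v = s
  · subst hvs
    have h4 := ndeg_symmDiff_edge_of_adj _ hadj
    have h5 := ndeg_symmDiff_edge_of_not_adj F hxs.ne.symm (fun h => hn h.symm)
    rw [edge_comm] at h5
    rw [← hF.full]
    omega
  rw [ndeg_symmDiff_edge_of_ne _ hsy.ne hvs hvy, ndeg_symmDiff_edge_of_ne _ hxs.ne hvx hvs,
    hF.full]

lemma IsOptimalFull.move (hF : IsOptimalFull G n Φ F) {u z : V} (hu : IsHole n F u)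
    (h : (isolate G Φ).Reachable u z) :
    ∃ F', IsOptimalFull G n Φ F' ∧ IsHole n F' z ∧ ∀ s ∈ Φ, ∀ b, F'.Adj s b ↔ F.Adj s b := by
  obtain ⟨p⟩ := h
  induction p generalizing F with
  | nil => exact ⟨F, hF, hu, fun _ _ _ => Iff.rfl⟩
  | @cons u x z hux _ ih =>
    obtain ⟨h1, h2, -⟩ := hF.toggle hu hux
    obtain ⟨F', h3, h4, h5⟩ := ih h1 h2
    refine ⟨F', h3, h4, fun s hs b => (h5 s hs b).trans ?_⟩
    obtain ⟨hadj, huΦ, hxΦ⟩ := hux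
    rw [symmDiff_edge_adj F hadj.ne, Sym2.eq_iff]
    grind

lemma IsOptimalFull.not_isHole (hF : IsOptimalFull G n Φ F) {u z : V} (hu : IsHole n F u)
    (h : (isolate G Φ).Reachable u z) (hzu : z ≠ u) : ¬IsHole n F z := by
  obtain ⟨p⟩ := h
  induction p generalizing F with
  | nil => exact absurd rfl hzu
  | @cons u x z hux _ ih =>
    obtain ⟨h1, h2, h3⟩ := hF.toggle hu hux
    by_cases hzx : z = x
    · subst hzx
      exact fun h => Nat.not_even_iff_odd.2 h3 h.1
    · have := ih h1 h2 hzx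
      rwa [IsHole, ndeg_symmDiff_edge_of_ne F hux.1.ne hzu hzx] at this

lemma IsOptimalFull.not_adj (hF : IsOptimalFull G n Φ F) {u z s : V} (hu : IsHole n F u)
    (h : (isolate G Φ).Reachable u z) (hs : s ∈ Φ) : ¬F.Adj s z := by
  obtain ⟨F', h1, h2, h3⟩ := hF.move hu h
  rw [← h3 s hs]
  intro hadj
  exact h1.notMem_of_odd
    (h1.toIsOptimal.toggle h2 (h1.le hadj.symm) (Or.inl hadj.symm)).2.2 hs

lemma IsOptimalFull.odd_supp (hF : IsOptimalFull G n Φ F) {u : V} (hu : IsHole n F u) :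
    Odd ((isolate G Φ).connectedComponentMk u).supp.ncard := by
  classical
  set C := ((isolate G Φ).connectedComponentMk u).supp with hC
  have hmem : ∀ z, z ∈ C ↔ (isolate G Φ).Reachable u z := fun z => by
    rw [hC, ConnectedComponent.mem_supp_iff, ConnectedComponent.eq, reachable_comm]
  let K : SimpleGraph V := isolate F Cᶜ
  have hKdeg : ∀ v, Odd (K.degree v) ↔ v ∈ C \ {u} := by
    intro v
    rw [← card_neighborSet_eq_degree, ← Nat.card_eq_fintype_card]
    by_cases hv : v ∈ C
    · have hK : K.neighborSet v = F.neighborSet v := by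
        ext b
        refine ⟨fun h => h.1, fun h => ⟨h, not_not.2 hv, not_not.2 ?_⟩⟩
        have hr := (hmem v).1 hv
        refine (hmem b).2 (hr.trans (Adj.reachable ⟨hF.le h, ?_, fun hb => ?_⟩))
        · exact hr.isolate_notMem (hF.notMem hu)
        · exact hF.not_adj hu hr hb h.symm
      rw [hK]
      change Odd (ndeg F v) ↔ _
      by_cases hvu : v = u
      · subst hvu
        simpa using hu.1
      · have h1 := hF.not_isHole hu ((hmem v).1 hv) hvu
        have h2 := ((hmem v).1 hv).isolate_notMem (hF.notMem hu)
        rw [← hF.full] at h2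
        have h3 := hF.ndeg_le v
        have : Odd (ndeg F v) := by
          rw [← Nat.not_even_iff_odd]
          exact fun h => h1 ⟨h, lt_of_le_of_ne h3 h2⟩
        simp [this, hv, hvu]
    · have hK : K.neighborSet v = ∅ := by
        ext b
        simp only [mem_neighborSet, Set.mem_empty_iff_false, iff_false]
        exact fun h => h.2.1 hv
      simp [hK, hv]
  have heven := K.even_card_odd_degree_vertices
  have hcard : ({v | Odd (K.degree v)} : Finset V).card = (C \ {u}).ncard := by
    rw [← Set.ncard_coe_finset]
    congr 1
    ext v
    simp [hKdeg]
  have := Set.ncard_sdiff_singleton_add_one (s := C) ((hmem u).2 (Reachable.refl _))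
    (Set.toFinite _)
  grind

/-- A set `R` of components of `G - Φ` reached by alternating paths from a hole of `F` through the
vertices in `S`. -/
structure IsAlternatingReach (G : SimpleGraph V) (n : ℕ) (Φ : Set V) (F : SimpleGraph V)
    (R : Finset (isolate G Φ).ConnectedComponent) (S : Finset V) : Prop where
  subset : ∀ s ∈ S, s ∈ Φ
  card : R.card = 2 * n * S.card + 1
  not_adj : ∀ s ∈ Φ, s ∉ S → ∀ z, (isolate G Φ).connectedComponentMk z ∈ R → ¬F.Adj s z
  exists_hole : ∀ z, (isolate G Φ).connectedComponentMk z ∈ R →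
    ∃ F', IsOptimalFull G n Φ F' ∧ IsHole n F' z ∧ ∀ s ∈ Φ, ∀ b,
      (s ∉ S ∨ (isolate G Φ).connectedComponentMk b ∉ R) → (F'.Adj s b ↔ F.Adj s b)

lemma IsOptimalFull.isAlternatingReach_singleton (hF : IsOptimalFull G n Φ F) {u : V}
    (hu : IsHole n F u) :
    IsAlternatingReach G n Φ F {(isolate G Φ).connectedComponentMk u} ∅ where
  subset := by simp
  card := by simp
  not_adj s hs _ z hz := by
    rw [Finset.mem_singleton, ConnectedComponent.eq] at hz
    exact hF.not_adj hu hz.symm hs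
  exists_hole z hz := by
    rw [Finset.mem_singleton, ConnectedComponent.eq] at hz
    obtain ⟨F', h1, h2, h3⟩ := hF.move hu hz.symm
    exact ⟨F', h1, h2, fun s hs b _ => h3 s hs b⟩

lemma IsAlternatingReach.extend {R : Finset (isolate G Φ).ConnectedComponent} {S : Finset V}
    (h : IsAlternatingReach G n Φ F R S) (hF : IsOptimalFull G n Φ F) {x s : V}
    (hx : (isolate G Φ).connectedComponentMk x ∈ R) (hs : s ∈ Φ) (hsS : s ∉ S)
    (hxs : G.Adj x s) :
    ∃ R' S', IsAlternatingReach G n Φ F R' S' ∧ S'.card = S.card + 1 := by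
  classical
  obtain ⟨F₁, hF₁, hx₁, hagree⟩ := h.exists_hole x hx
  have hxΦ := hF₁.notMem hx₁
  let mk := (isolate G Φ).connectedComponentMk
  have hnew : ∀ y, F.Adj s y → mk y ∉ R := fun y hy hyR => h.not_adj s hs hsS y hyR hy
  have hswap : ∀ y, F.Adj s y → IsOptimalFull G n Φ ((F₁ ∆ edge x s) ∆ edge s y) ∧
      IsHole n ((F₁ ∆ edge x s) ∆ edge s y) y ∧ y ∉ Φ := fun y hy =>
    hF₁.swap hx₁ hs hxs ((hagree s hs y (Or.inl hsS)).2 hy)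
  have hadj : ∀ y, F.Adj s y → ∀ t ∈ Φ, ∀ b, (t ≠ s ∧ t ∉ S ∨ b ≠ y ∧ mk b ∉ R) →
      (((F₁ ∆ edge x s) ∆ edge s y).Adj t b ↔ F.Adj t b) := by
    intro y hy t ht b hb
    have hyΦ := (hswap y hy).2.2
    have hbx : t ≠ s ∨ b ≠ x := by
      rcases hb with hb | hb
      · exact Or.inl hb.1
      · refine Or.inr ?_
        rintro rfl
        exact hb.2 hx
    rw [← hagree t ht b (by tauto), symmDiff_edge_adj _ hy.ne, symmDiff_edge_adj _ hxs.ne,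
      Sym2.eq_iff, Sym2.eq_iff]
    grind
  have hlone : ∀ y, F.Adj s y → ∀ t ∈ Φ, ∀ b, mk b = mk y → F.Adj t b → t = s ∧ b = y := by
    intro y hy t ht b hby htb
    obtain ⟨h1, h2, -⟩ := hswap y hy
    have hbR : mk b ∉ R := hby ▸ hnew y hy
    have h3 := h1.not_adj h2 (ConnectedComponent.exact hby.symm) ht
    have hb : b = y := by
      by_contra hb
      exact h3 ((hadj y hy t ht b (Or.inr ⟨hb, hbR⟩)).2 htb)
    refine ⟨?_, hb⟩
    by_contra hts
    subst hb
    refine h3 ?_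
    rw [symmDiff_edge_adj _ hy.ne, symmDiff_edge_adj _ hxs.ne,
      hagree t ht b (Or.inr hbR), Sym2.eq_iff, Sym2.eq_iff]
    grind
  let N := (F.neighborSet s).toFinset
  have hN : ∀ y, y ∈ N ↔ F.Adj s y := by simp [N]
  have hNcard : N.card = 2 * n := by
    rw [← (hF.full s).2 hs, ndeg, Nat.card_eq_fintype_card, Set.toFinset_card]
  have himg : (N.image mk).card = 2 * n := by
    rw [Finset.card_image_of_injOn, hNcard]
    intro y hy y' hy' hyy'
    rw [Finset.mem_coe, hN] at hy hy'
    exact (hlone y' hy' s hs y hyy' hy).2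
  refine ⟨R ∪ N.image mk, insert s S, ⟨?_, ?_, ?_, ?_⟩, Finset.card_insert_of_notMem hsS⟩
  · intro t ht
    rcases Finset.mem_insert.1 ht with rfl | ht
    · exact hs
    · exact h.subset t ht
  · rw [Finset.card_union_of_disjoint, himg, h.card, Finset.card_insert_of_notMem hsS]
    · ring
    · rw [Finset.disjoint_right]
      intro c hc
      obtain ⟨y, hy, rfl⟩ := Finset.mem_image.1 hc
      exact hnew y ((hN y).1 hy)
  · intro t ht htS z hz hadj'
    rw [Finset.mem_insert, not_or] at htS
    rcases Finset.mem_union.1 hz with hz | hz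
    · exact h.not_adj t ht htS.2 z hz hadj'
    · obtain ⟨y, hy, hyz⟩ := Finset.mem_image.1 hz
      exact htS.1 (hlone y ((hN y).1 hy) t ht z hyz.symm hadj').1
  · intro z hz
    rcases Finset.mem_union.1 hz with hz | hz
    · obtain ⟨F₂, h1, h2, h3⟩ := h.exists_hole z hz
      refine ⟨F₂, h1, h2, fun t ht b hb => h3 t ht b ?_⟩
      rw [Finset.mem_insert, Finset.mem_union] at hb
      tauto
    · obtain ⟨y, hy, hyz⟩ := Finset.mem_image.1 hz
      have hy' := (hN y).1 hy
      obtain ⟨h1, h2, -⟩ := hswap y hy'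
      obtain ⟨F₂, h3, h4, h5⟩ := h1.move h2 (ConnectedComponent.exact hyz)
      refine ⟨F₂, h3, h4, fun t ht b hb => (h5 t ht b).trans (hadj y hy' t ht b ?_)⟩
      rw [Finset.mem_insert, Finset.mem_union, not_or, not_or] at hb
      refine hb.imp id fun hb => ⟨?_, hb.1⟩
      rintro rfl
      exact hb.2 (Finset.mem_image_of_mem _ hy)

/-- Some alternating reach is closed under further extension. -/
lemma IsOptimalFull.exists_closed_reach (hF : IsOptimalFull G n Φ F) {u : V}
    (hu : IsHole n F u) :
    ∃ R S, IsAlternatingReach G n Φ F R S ∧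
      ∀ x s, (isolate G Φ).connectedComponentMk x ∈ R → s ∈ Φ → G.Adj x s → s ∈ S := by
  by_contra! hcon
  have key : ∀ k : ℕ, ∃ R S, IsAlternatingReach G n Φ F R S ∧ S.card = k := by
    intro k
    induction k with
    | zero => exact ⟨_, _, hF.isAlternatingReach_singleton hu, Finset.card_empty⟩
    | succ k ih =>
      obtain ⟨R, S, h, rfl⟩ := ih
      obtain ⟨x, s, hx, hs, hxs, hsS⟩ := hcon R S h
      exact h.extend hF hx hs hsS hxs
  obtain ⟨R, S, -, hS⟩ := key (Fintype.card V + 1)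
  have := S.card_le_univ
  omega

/-- The components in a closed alternating reach are odd components of `G - S`. -/
lemma IsAlternatingReach.card_le_oddComp {R : Finset (isolate G Φ).ConnectedComponent}
    {S : Finset V} (h : IsAlternatingReach G n Φ F R S)
    (hclosed : ∀ x s, (isolate G Φ).connectedComponentMk x ∈ R → s ∈ Φ → G.Adj x s → s ∈ S) :
    R.card ≤ oddComp G (S : Set V) := by
  classical
  let mk := (isolate G Φ).connectedComponentMk
  have hΦ : ∀ x, mk x ∈ R → x ∉ Φ := by
    intro x hx
    obtain ⟨F', h1, h2, -⟩ := h.exists_hole x hx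
    exact h1.notMem h2
  have hS : ∀ x, mk x ∈ R → x ∈ (S : Set V)ᶜ := fun x hx hxS => hΦ x hx (h.subset x hxS)
  have hto : ∀ a b : ((S : Set V)ᶜ : Set V), (G.induce (S : Set V)ᶜ).Reachable a b →
      mk a ∈ R → mk a = mk b := by
    rintro a b ⟨p⟩ ha
    induction p with
    | nil => rfl
    | @cons a c b hac _ ih =>
      have hadj : G.Adj a c := hac
      have : mk a = mk c := ConnectedComponent.sound
        (Adj.reachable ⟨hadj, hΦ a ha, fun hc => c.2 (hclosed a c ha hc hadj)⟩)
      rw [this]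
      exact ih (this ▸ ha)
  have hfrom : ∀ a b : V, (isolate G Φ).Reachable a b → ∀ (ha : a ∈ (S : Set V)ᶜ)
      (hb : b ∈ (S : Set V)ᶜ), (G.induce (S : Set V)ᶜ).Reachable ⟨a, ha⟩ ⟨b, hb⟩ := by
    rintro a b ⟨p⟩ ha hb
    induction p with
    | nil => exact Reachable.refl _
    | @cons a c b hac _ ih =>
      have hc : c ∈ (S : Set V)ᶜ := fun hc => hac.2.2 (h.subset c hc)
      have hadj : (G.induce (S : Set V)ᶜ).Adj ⟨a, ha⟩ ⟨c, hc⟩ := hac.1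
      exact hadj.reachable.trans (ih hc hb)
  have hout : ∀ c : R, mk c.1.out ∈ R := fun c => by
    have : mk c.1.out = c.1 := Quot.out_eq _
    rw [this]
    exact c.2
  let r : R → ((S : Set V)ᶜ : Set V) := fun c => ⟨c.1.out, hS _ (hout c)⟩
  have hodd : ∀ c : R,
      Odd (Nat.card ((G.induce (S : Set V)ᶜ).connectedComponentMk (r c)).supp) := by
    intro c
    obtain ⟨F', h1, h2, -⟩ := h.exists_hole _ (hout c)
    have h3 := h1.odd_supp h2
    rw [Nat.card_coe_set_eq, ← Set.ncard_image_of_injective _ Subtype.val_injective]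
    convert h3 using 2
    ext z
    simp only [Set.mem_image, ConnectedComponent.mem_supp_iff, ConnectedComponent.eq]
    constructor
    · rintro ⟨b, hb, rfl⟩
      exact (ConnectedComponent.exact (hto _ _ hb.symm (hout c))).symm
    · intro hz
      have hzR : mk z ∈ R := by
        have : mk z = mk c.1.out := ConnectedComponent.sound hz
        exact this ▸ hout c
      exact ⟨⟨z, hS z hzR⟩, hfrom _ _ hz _ _, rfl⟩
  rw [oddComp, ← Fintype.card_coe, ← Nat.card_eq_fintype_card]
  refine Nat.card_le_card_of_injective (fun c => ⟨_, hodd c⟩) fun c d hcd => ?_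
  have h1 := hto _ _ (ConnectedComponent.exact (Subtype.ext_iff.1 hcd)) (hout c)
  have hc : mk c.1.out = c.1 := Quot.out_eq _
  have hd : mk d.1.out = d.1 := Quot.out_eq _
  exact Subtype.ext (hc.symm.trans (h1.trans hd))

lemma exists_maximal_isOptimal (G : SimpleGraph V) (n : ℕ) :
    ∃ F, Maximal (IsOptimal G n) F := by
  let A : Set (SimpleGraph V) := {F | F ≤ G ∧ ∀ v, ndeg F v ≤ 2 * n}
  have hbot : (⊥ : SimpleGraph V) ∈ A := ⟨bot_le, fun v => by simp [ndeg]⟩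
  obtain ⟨F, hF, hmin⟩ := A.toFinite.exists_minimalFor (fun F => {v | IsHole n F v}.ncard) A
    ⟨_, hbot⟩
  have hopt : IsOptimal G n F := ⟨hF.1, hF.2, fun F' h1 h2 =>
    (le_total _ _).elim id fun h => hmin ⟨h1, h2⟩ h⟩
  obtain ⟨F', -, hF'⟩ := (Set.toFinite {F | IsOptimal G n F}).exists_le_maximal hopt
  exact ⟨F', hF'⟩

end Finite

end SimpleGraph

/-- Corollary: connected odd-order graph with minimum degree `2n-1` satisfying
`o(G-S) ≤ 2n|S|` for all nonempty `S` has an `H_n`-factor. -/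
theorem stmt_4 {V : Type*} [Fintype V] (G : SimpleGraph V) (n : ℕ) (hn : 2 ≤ n)
    (hconn : G.Connected) (hodd : Odd (Fintype.card V))
    (hdeg : ∀ v, 2 * n - 1 ≤ ndeg G v)
    (hcond : ∀ S : Finset V, S.Nonempty → oddComp G (↑S : Set V) ≤ 2 * n * S.card) :
    ∃ F : SimpleGraph V, F ≤ G ∧
      ∀ v : V, (Odd (ndeg F v) ∧ ndeg F v ≤ 2 * n - 1) ∨ ndeg F v = 2 * n := by
  obtain ⟨F, hF, hmax⟩ := exists_maximal_isOptimal G n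
  by_cases hholes : ∃ u, IsHole n F u
  swap
  · push Not at hholes
    refine ⟨F, hF.le, fun v => ?_⟩
    have h1 := hholes v
    have h2 := hF.ndeg_le v
    rw [IsHole] at h1
    by_cases h3 : ndeg F v = 2 * n
    · exact Or.inr h3
    · refine Or.inl ⟨?_, by omega⟩
      rw [← Nat.not_even_iff_odd]
      exact fun h => h1 ⟨h, by omega⟩
  exfalso
  obtain ⟨u, hu⟩ := hholes
  have hfull : IsOptimalFull G n {v | ndeg F v = 2 * n} F := ⟨hF, fun _ => Iff.rfl⟩
  obtain ⟨R, S, hR, hclosed⟩ := hfull.exists_closed_reach hu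
  rcases S.eq_empty_or_nonempty with rfl | hS
  swap
  · have h1 := hR.card_le_oddComp hclosed
    have h2 := hcond S hS
    have h3 := hR.card
    omega
  have hmem : ∀ x, (isolate G {v | ndeg F v = 2 * n}).connectedComponentMk x ∈ R →
      ndeg F x ≠ 2 * n := by
    intro x hx
    obtain ⟨F', h1, h2, -⟩ := hR.exists_hole x hx
    exact h1.notMem h2
  obtain ⟨c, hc⟩ : R.Nonempty := by
    rw [← Finset.card_pos, hR.card]
    omega
  have hall : ∀ x, (isolate G {v | ndeg F v = 2 * n}).connectedComponentMk x ∈ R := by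
    intro x
    obtain ⟨y, rfl⟩ := c.exists_rep
    obtain ⟨p⟩ := hconn.preconnected y x
    induction p with
    | nil => exact hc
    | @cons a b z hab _ ih =>
      have hb : ndeg F b ≠ 2 * n := fun h => by simpa using hclosed a b hc h hab
      refine ih ?_
      have hadj : (isolate G {v | ndeg F v = 2 * n}).Adj a b := ⟨hab, hmem a hc, hb⟩
      change (isolate G {v | ndeg F v = 2 * n}).connectedComponentMk b ∈ R
      rw [← ConnectedComponent.sound hadj.reachable]
      exact hc
  obtain ⟨x, hux, hnot⟩ : ∃ x, G.Adj u x ∧ ¬F.Adj u x := by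
    by_contra! hcon
    have h1 : ndeg G u ≤ ndeg F u := Nat.card_mono (Set.toFinite _) hcon
    have h2 := hdeg u
    have := hu.2
    have := hu.1
    grind
  have hopt := (hF.toggle hu hux (Or.inr (hmem x (hall x)))).1
  have hle : F ≤ symmDiff F (edge u x) := by
    intro a b hab
    rw [symmDiff_edge_adj F hux.ne]
    intro h
    have h2 := h.1 hab
    rw [Sym2.eq_iff] at h2
    rcases h2 with ⟨rfl, rfl⟩ | ⟨rfl, rfl⟩
    · exact hnot hab
    · exact hnot hab.symm
  refine hnot (hmax hopt hle ?_)
  rw [symmDiff_edge_adj F hux.ne]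
  simp [hnot]
end
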